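/- arXiv:2203.02873 — 13 statements merged into one kernel-verified Lean document; each statement's English description precedes it below -/
import Mathlib

section
/- The complementarity knapsack polytope PS is full-dimensional, i.e., the affine span of PS is all of ℝ^I (equivalently, PS has affine dimension d). -/
open Finset

namespace CKP

/-- The index set `I`: pairs `(i, j)` with `i ∈ M = {1,…,m}` and `j ∈ N_i = {1,…,n_i}`. -/
abbrev Idx {m : ℕ} (n : Fin m → ℕ) := Σ i : Fin m, Fin (n i)

/-- The feasible set `S` of the complementarity knapsack problem: points of `[0,1]^I`
satisfying the knapsack constraint and the complementarity constraints. -/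
def S {m : ℕ} (n : Fin m → ℕ) (a : Idx n → ℝ) (b : ℝ) : Set (Idx n → ℝ) :=
  {x | (∀ q : Idx n, x q ∈ Set.Icc (0 : ℝ) 1) ∧
       (∑ q : Idx n, a q * x q) ≤ b ∧
       ∀ (i : Fin m) (j j' : Fin (n i)), j ≠ j' → x ⟨i, j⟩ * x ⟨i, j'⟩ = 0}

/-- The complementarity knapsack polytope `PS = conv(S)`. -/
def PS {m : ℕ} (n : Fin m → ℕ) (a : Idx n → ℝ) (b : ℝ) : Set (Idx n → ℝ) :=
  convexHull ℝ (S n a b)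

end CKP

namespace CKP

/-- A point with at most one nonzero coordinate is feasible as soon as that coordinate lies in
`[0,1]` and respects the knapsack constraint. -/
theorem single_mem_S {m : ℕ} {n : Fin m → ℕ} {a : Idx n → ℝ} {b : ℝ} {q : Idx n} {t : ℝ}
    (ht0 : 0 ≤ t) (ht1 : t ≤ 1) (hat : a q * t ≤ b) : Pi.single q t ∈ S n a b := by
  refine ⟨fun p => ?_, ?_, fun i j j' hj => ?_⟩
  · rcases eq_or_ne p q with rfl | hp
    · simpa using ⟨ht0, ht1⟩
    · simp [hp]
  · simpa [Pi.single_apply] using hat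
  · by_cases h : (⟨i, j⟩ : Idx n) = q
    · have h' : (⟨i, j'⟩ : Idx n) ≠ q := by
        rintro rfl
        exact hj (by simpa using h)
      simp [h']
    · simp [h]

end CKP

/-- The complementarity knapsack polytope `PS` is full-dimensional:
its affine span is all of `ℝ^I`. -/
theorem ckp_PS_full_dimensional {m : ℕ} (n : Fin m → ℕ) (hn : ∀ i, 0 < n i)
    (a : CKP.Idx n → ℝ) (b : ℝ)
    (ha : ∀ q : CKP.Idx n, 0 ≤ a q)
    (hmono : ∀ (i : Fin m) (j j' : Fin (n i)), (j : ℕ) ≤ (j' : ℕ) → a ⟨i, j'⟩ ≤ a ⟨i, j⟩)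
    (hb : 0 < b)
    (hM : ∃ i, n i ≠ 1)
    (hbig : b < ∑ i : Fin m, a ⟨i, ⟨0, hn i⟩⟩) :
    affineSpan ℝ (CKP.PS n a b) = ⊤ := by
  rw [CKP.PS, affineSpan_convexHull]
  have h0 : (0 : CKP.Idx n → ℝ) ∈ CKP.S n a b :=
    ⟨fun q => by simp, by simpa using hb.le, fun i j j' _ => by simp⟩
  rw [AffineSubspace.affineSpan_eq_top_iff_vectorSpan_eq_top_of_nonempty ℝ _ _ ⟨0, h0⟩,
    vectorSpan_eq_span_vsub_set_right ℝ h0, eq_top_iff,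
    ← (Pi.basisFun ℝ (CKP.Idx n)).span_eq, Submodule.span_le]
  rintro _ ⟨q, rfl⟩
  have hpos : 0 < b + a q := add_pos_of_pos_of_nonneg hb (ha q)
  have hmem : Pi.single q (b / (b + a q)) ∈ CKP.S n a b := by
    refine CKP.single_mem_S (by positivity) ?_ ?_
    · rw [div_le_one hpos]
      linarith [ha q]
    · rw [← mul_div_assoc, div_le_iff₀ hpos]
      nlinarith [mul_pos hb hb]
  have hspan : Pi.single q (b / (b + a q)) ∈
      Submodule.span ℝ ((· -ᵥ (0 : CKP.Idx n → ℝ)) '' CKP.S n a b) :=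
    Submodule.subset_span ⟨_, hmem, by simp⟩
  have hsmul := Submodule.smul_mem _ ((b + a q) / b) hspan
  rw [← Pi.single_smul, smul_eq_mul, div_mul_div_cancel₀ hb.ne', div_self hpos.ne'] at hsmul
  simpa only [SetLike.mem_coe, Pi.basisFun_apply] using hsmul
end

section
/- If x̃ is an extreme point of the complementarity knapsack polytope PS that is not an integral vector, then x̃ has exactly one component lying strictly between 0 and 1, and x̃ satisfies the knapsack constraint at equality: ∑_{(i,j)∈I} a_{ij} x̃_{ij} = b. -/
open Finset

namespace CKP

open Topology Filter

/-- Small perturbations of a feasible point along a direction supported on its fractional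
components stay feasible, unless they can violate a tight knapsack constraint. -/
theorem eventually_add_smul_mem_S {m : ℕ} {n : Fin m → ℕ} {a : Idx n → ℝ} {b : ℝ}
    {x v : Idx n → ℝ} (hx : x ∈ S n a b) (hv : ∀ q, v q ≠ 0 → 0 < x q ∧ x q < 1)
    (hav : ∑ q, a q * x q < b ∨ ∑ q, a q * v q = 0) :
    ∀ᶠ ε in 𝓝 (0 : ℝ), x + ε • v ∈ S n a b := by
  obtain ⟨hx01, hxb, hxc⟩ := hx
  have hbox : ∀ᶠ ε in 𝓝 (0 : ℝ), ∀ q, x q + ε * v q ∈ Set.Icc (0 : ℝ) 1 := by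
    refine eventually_all.2 fun q => ?_
    by_cases hq : v q = 0
    · simpa [hq] using hx01 q
    · have hc : Tendsto (fun ε : ℝ => x q + ε * v q) (𝓝 0) (𝓝 (x q)) :=
        Continuous.tendsto' (by fun_prop) _ _ (by simp)
      exact hc (Icc_mem_nhds (hv q hq).1 (hv q hq).2)
  have hsum (ε : ℝ) : ∑ q, a q * (x q + ε * v q) = ∑ q, a q * x q + ε * ∑ q, a q * v q := by
    rw [mul_sum, ← sum_add_distrib]
    exact sum_congr rfl fun q _ => by ring
  have hknap : ∀ᶠ ε in 𝓝 (0 : ℝ), ∑ q, a q * (x q + ε * v q) ≤ b := by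
    simp only [hsum]
    rcases hav with h | h
    · have hc : Tendsto (fun ε : ℝ => ∑ q, a q * x q + ε * ∑ q, a q * v q) (𝓝 0)
          (𝓝 (∑ q, a q * x q)) :=
        Continuous.tendsto' (by fun_prop) _ _ (by simp)
      exact hc (Iic_mem_nhds h)
    · simpa [h] using hxb
  have hsupp (q : Idx n) (hq : x q = 0) : v q = 0 := by
    by_contra h
    exact (hv q h).1.ne' hq
  filter_upwards [hbox, hknap] with ε h₁ h₂
  refine ⟨h₁, h₂, fun i j j' hj => ?_⟩
  rcases mul_eq_zero.1 (hxc i j j' hj) with h | h <;> simp [h, hsupp _ h]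

/-- At a vertex, no nonzero direction supported on the fractional components is feasible. -/
theorem eq_zero_of_mem_extremePoints {m : ℕ} {n : Fin m → ℕ} {a : Idx n → ℝ} {b : ℝ}
    {x v : Idx n → ℝ} (hx : x ∈ Set.extremePoints ℝ (PS n a b))
    (hv : ∀ q, v q ≠ 0 → 0 < x q ∧ x q < 1)
    (hav : ∑ q, a q * x q < b ∨ ∑ q, a q * v q = 0) : v = 0 := by
  have hev := eventually_add_smul_mem_S (extremePoints_convexHull_subset hx) hv hav
  have hneg : ∀ᶠ ε in 𝓝 (0 : ℝ), x + (-ε) • v ∈ S n a b :=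
    (Continuous.tendsto' continuous_neg (0 : ℝ) 0 neg_zero).eventually hev
  obtain ⟨ε, ⟨h₁, h₂⟩, hε⟩ := (((hev.and hneg).filter_mono nhdsWithin_le_nhds).and
    (self_mem_nhdsWithin : Set.Ioi (0 : ℝ) ∈ 𝓝[>] 0)).exists
  have hmem : x ∈ openSegment ℝ (x + ε • v) (x + (-ε) • v) :=
    ⟨1 / 2, 1 / 2, by norm_num, by norm_num, by norm_num, by module⟩
  have heq := hx.2 (subset_convexHull ℝ _ h₁) (subset_convexHull ℝ _ h₂) hmem
  simpa [(show (0 : ℝ) < ε from hε).ne'] using heq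

end CKP

/-- A non-integral extreme point of `PS` has exactly one fractional
component and satisfies the knapsack constraint at equality. -/
theorem ckp_nonintegral_vertex {m : ℕ} (n : Fin m → ℕ) (hn : ∀ i, 0 < n i)
    (a : CKP.Idx n → ℝ) (b : ℝ)
    (ha : ∀ q : CKP.Idx n, 0 ≤ a q)
    (hmono : ∀ (i : Fin m) (j j' : Fin (n i)), (j : ℕ) ≤ (j' : ℕ) → a ⟨i, j'⟩ ≤ a ⟨i, j⟩)
    (hb : 0 < b)
    (hM : ∃ i, n i ≠ 1)
    (hbig : b < ∑ i : Fin m, a ⟨i, ⟨0, hn i⟩⟩)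
    (x : CKP.Idx n → ℝ)
    (hx : x ∈ Set.extremePoints ℝ (CKP.PS n a b))
    (hfrac : ¬ ∀ q : CKP.Idx n, x q = 0 ∨ x q = 1) :
    (∃! q : CKP.Idx n, 0 < x q ∧ x q < 1) ∧ (∑ q : CKP.Idx n, a q * x q) = b := by
  have hS : x ∈ CKP.S n a b := extremePoints_convexHull_subset hx
  have key (q) (hq : 0 < x q ∧ x q < 1) : ∑ q, a q * x q = b ∧ a q ≠ 0 := by
    have hsupp (r) (hr : (Pi.single q 1 : CKP.Idx n → ℝ) r ≠ 0) : 0 < x r ∧ x r < 1 := by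
      by_cases h : r = q
      · exact h ▸ hq
      · simp [h] at hr
    have hne : (Pi.single q 1 : CKP.Idx n → ℝ) ≠ 0 := by simp
    constructor
    · by_contra h
      exact hne (CKP.eq_zero_of_mem_extremePoints hx hsupp (.inl (lt_of_le_of_ne hS.2.1 h)))
    · intro h
      refine hne (CKP.eq_zero_of_mem_extremePoints hx hsupp (.inr ?_))
      simp [Pi.single_apply, h]
  push Not at hfrac
  obtain ⟨q, h0, h1⟩ := hfrac
  have hq : 0 < x q ∧ x q < 1 :=
    ⟨lt_of_le_of_ne (hS.1 q).1 h0.symm, lt_of_le_of_ne (hS.1 q).2 h1⟩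
  refine ⟨⟨q, hq, fun r hr => ?_⟩, (key q hq).1⟩
  by_contra hrq
  have hzero : (Pi.single r (a q) - Pi.single q (a r) : CKP.Idx n → ℝ) = 0 := by
    refine CKP.eq_zero_of_mem_extremePoints hx (fun p hp => ?_) (.inr ?_)
    · by_cases hpr : p = r
      · exact hpr ▸ hr
      · by_cases hpq : p = q
        · exact hpq ▸ hq
        · simp [hpr, hpq] at hp
    · simp [Pi.single_apply, mul_sub, sum_sub_distrib, mul_comm]
  exact (key q hq).2 (by simpa [hrq] using congrFun hzero r)
end

section
/- Let C = {(i, r_i) : i ∈ M_C} ⊆ I be a cover, and suppose there exist i' ∈ M_C and j' ∈ N_{i'} with r_{i'} < j' ≤ n_{i'} such that ∑_{i∈M_C, i≠i'} a_{i r_i} + a_{i'j'} < b. Then every x ∈ S (hence every x ∈ PS) satisfies the lifted cover inequality ∑_{i∈M_C} ∑_{j=1}^{r_i−1} a_{i r_i} x_{ij} + ∑_{i∈M_C} ∑_{j=r_i}^{n_i} max{ a_{ij}, b − ∑_{k∈M_C, k≠i} a_{k r_k} } x_{ij} ≤ b. -/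
open Finset

/-- Left-hand side of the lifted cover inequality (3)/(q1), for the cover
`C = {(i, r i) : i ∈ MC}` (indices `j` are 0-based, so `j = r i` corresponds to the
cover element). -/
def q1LHS {m : ℕ} (n : Fin m → ℕ) (a : CKP.Idx n → ℝ) (b : ℝ)
    (MC : Finset (Fin m)) (r : ∀ i, Fin (n i)) (x : CKP.Idx n → ℝ) : ℝ :=
  ∑ i ∈ MC, ∑ j : Fin (n i),
    (if (j : ℕ) < (r i : ℕ) then a ⟨i, r i⟩
     else max (a ⟨i, j⟩) (b - ∑ k ∈ MC.erase i, a ⟨k, r k⟩)) * x ⟨i, j⟩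

theorem sum_mul_le_of_pairwise_mul_eq_zero {ι : Type*} [Fintype ι] {c y : ι → ℝ} {B : ℝ}
    (hB : 0 ≤ B) (hy : ∀ j, y j ∈ Set.Icc (0 : ℝ) 1)
    (hcomp : ∀ j j', j ≠ j' → y j * y j' = 0) (hc : ∀ j, y j ≠ 0 → c j ≤ B) :
    ∑ j, c j * y j ≤ B := by
  by_cases h : ∃ j, y j ≠ 0
  · obtain ⟨j, hj⟩ := h
    rw [Fintype.sum_eq_single j fun k hk => by
      rw [(mul_eq_zero.mp (hcomp j k hk.symm)).resolve_left hj, mul_zero]]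
    calc c j * y j ≤ B * y j := mul_le_mul_of_nonneg_right (hc j hj) (hy j).1
      _ ≤ B := mul_le_of_le_one_right hB (hy j).2
  · push Not at h
    simpa [h] using hB

theorem isLinearMap_q1LHS {m : ℕ} (n : Fin m → ℕ) (a : CKP.Idx n → ℝ) (b : ℝ)
    (MC : Finset (Fin m)) (r : ∀ i, Fin (n i)) : IsLinearMap ℝ (q1LHS n a b MC r) where
  map_add x y := by simp only [q1LHS, Pi.add_apply, mul_add, sum_add_distrib]
  map_smul t x := by
    simp only [q1LHS, Pi.smul_apply, smul_eq_mul, mul_sum]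
    exact sum_congr rfl fun _ _ => sum_congr rfl fun _ _ => mul_left_comm _ _ _

/-- The lifted cover inequality holds on the feasible set for every cover. -/
theorem q1LHS_le_of_mem_S {m : ℕ} {n : Fin m → ℕ} {a : CKP.Idx n → ℝ} {b : ℝ}
    (ha : ∀ q : CKP.Idx n, 0 ≤ a q)
    (hmono : ∀ (i : Fin m) (j j' : Fin (n i)), (j : ℕ) ≤ (j' : ℕ) → a ⟨i, j'⟩ ≤ a ⟨i, j⟩)
    {MC : Finset (Fin m)} {r : ∀ i, Fin (n i)}
    (hcover : b < ∑ i ∈ MC, a ⟨i, r i⟩) {x : CKP.Idx n → ℝ} (hx : x ∈ CKP.S n a b) :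
    q1LHS n a b MC r x ≤ b := by
  obtain ⟨hbox, hknap, hcomp⟩ := hx
  unfold q1LHS
  by_cases h : ∃ i ∈ MC, ∃ j : Fin (n i), (r i : ℕ) ≤ j ∧ x ⟨i, j⟩ ≠ 0 ∧
      a ⟨i, j⟩ < b - ∑ k ∈ MC.erase i, a ⟨k, r k⟩
  · obtain ⟨i, hi, j, hrj, hxj, haj⟩ := h
    rw [← add_sum_erase _ _ hi]
    have hfirst : ∑ l : Fin (n i), (if (l : ℕ) < (r i : ℕ) then a ⟨i, r i⟩
        else max (a ⟨i, l⟩) (b - ∑ k ∈ MC.erase i, a ⟨k, r k⟩)) * x ⟨i, l⟩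
        ≤ b - ∑ k ∈ MC.erase i, a ⟨k, r k⟩ := by
      refine sum_mul_le_of_pairwise_mul_eq_zero ((ha _).trans haj.le) (fun l => hbox ⟨i, l⟩)
        (hcomp i) fun l hl => ?_
      obtain rfl : l = j := by
        by_contra hne
        exact mul_ne_zero hl hxj (hcomp i l j hne)
      rw [if_neg hrj.not_gt, max_eq_right haj.le]
    have hrest := sum_le_sum fun k (hk : k ∈ MC.erase i) =>
      sum_mul_le_of_pairwise_mul_eq_zero
        (c := fun l : Fin (n k) => if (l : ℕ) < (r k : ℕ) then a ⟨k, r k⟩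
          else max (a ⟨k, l⟩) (b - ∑ k' ∈ MC.erase k, a ⟨k', r k'⟩))
        (ha ⟨k, r k⟩) (fun l => hbox ⟨k, l⟩) (hcomp k) fun l _ => by
          split_ifs with hl
          · exact le_rfl
          · refine max_le (hmono k _ _ (not_lt.mp hl)) ?_
            have := add_sum_erase MC (fun k => a ⟨k, r k⟩) (mem_of_mem_erase hk)
            linarith
    linarith
  · push Not at h
    refine le_trans ?_ hknap
    rw [Fintype.sum_sigma]
    refine (sum_le_sum fun i hi => sum_le_sum fun j _ => ?_).trans
      (sum_le_univ_sum_of_nonneg fun i =>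
        sum_nonneg fun j _ => mul_nonneg (ha ⟨i, j⟩) (hbox ⟨i, j⟩).1)
    by_cases hxj : x ⟨i, j⟩ = 0
    · simp [hxj]
    · refine mul_le_mul_of_nonneg_right ?_ (hbox ⟨i, j⟩).1
      split_ifs with hj
      · exact hmono i _ _ hj.le
      · exact max_le le_rfl (h i hi j (not_lt.mp hj) hxj)

/-- Theorem 3 in de Farias et al., validity. Let `C = {(i, r i) : i ∈ MC}`
be a cover admitting `i' ∈ M_C` and `j' > r i'` with
`∑_{i ∈ M_C, i ≠ i'} a_{i r_i} + a_{i' j'} < b`. Then the lifted cover inequality (q1)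
is valid for every point of `PS` (in particular for every point of `S ⊆ PS`). -/
theorem ckp_lifted_cover_ineq1_valid {m : ℕ} (n : Fin m → ℕ) (hn : ∀ i, 0 < n i)
    (a : CKP.Idx n → ℝ) (b : ℝ)
    (ha : ∀ q : CKP.Idx n, 0 ≤ a q)
    (hmono : ∀ (i : Fin m) (j j' : Fin (n i)), (j : ℕ) ≤ (j' : ℕ) → a ⟨i, j'⟩ ≤ a ⟨i, j⟩)
    (hb : 0 < b)
    (hM : ∃ i, n i ≠ 1)
    (hbig : b < ∑ i : Fin m, a ⟨i, ⟨0, hn i⟩⟩)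
    (MC : Finset (Fin m)) (r : ∀ i, Fin (n i))
    (hcover : b < ∑ i ∈ MC, a ⟨i, r i⟩)
    (i' : Fin m) (hi' : i' ∈ MC) (j' : Fin (n i'))
    (hrj : (r i' : ℕ) < (j' : ℕ))
    (hlift : (∑ i ∈ MC.erase i', a ⟨i, r i⟩) + a ⟨i', j'⟩ < b)
    (x : CKP.Idx n → ℝ) (hx : x ∈ CKP.PS n a b) :
    q1LHS n a b MC r x ≤ b := by
  exact convexHull_min (fun _ hy => q1LHS_le_of_mem_S ha hmono hcover hy)
    (convex_halfSpace_le (isLinearMap_q1LHS n a b MC r) b) hx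
end

section
/- Let C = {(i, r_i) : i ∈ M_C} ⊆ I be a cover with r_i = 1 for every i ∈ M_C, and suppose there exist i' ∈ M_C and j' ∈ N_{i'} with 1 < j' ≤ n_{i'} such that ∑_{i∈M_C, i≠i'} a_{i1} + a_{i'j'} < b. Then the lifted cover inequality ∑_{i∈M_C} ∑_{j=1}^{n_i} max{ a_{ij}, b − ∑_{k∈M_C, k≠i} a_{k1} } x_{ij} ≤ b is facet-defining for PS. -/
open Finset

namespace CKP

/-- An inequality `f x ≤ δ` is facet-defining for `PS` if it is valid for `PS` and the
face it induces has affine dimension `d - 1`, where `d = ∑ i, n i` is the dimension of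
the ambient space. -/
def IsFacetDefining {m : ℕ} (n : Fin m → ℕ) (a : Idx n → ℝ) (b : ℝ)
    (f : (Idx n → ℝ) → ℝ) (δ : ℝ) : Prop :=
  (∀ x ∈ PS n a b, f x ≤ δ) ∧
  Module.finrank ℝ (affineSpan ℝ {x ∈ PS n a b | f x = δ}).direction =
    Fintype.card (Idx n) - 1

end CKP

namespace CKP

variable {m : ℕ} {n : Fin m → ℕ}

/-- The coefficient vector of the lifted cover inequality when every cover element comes first
in its complementarity group. -/
noncomputable def liftCoeff (a : Idx n → ℝ) (b : ℝ) (MC : Finset (Fin m)) (r : ∀ i, Fin (n i))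
    (q : Idx n) : ℝ :=
  if q.1 ∈ MC then max (a q) (b - ∑ k ∈ MC.erase q.1, a ⟨k, r k⟩) else 0

lemma q1LHS_eq_sum_liftCoeff (a : Idx n → ℝ) (b : ℝ) (MC : Finset (Fin m))
    (r : ∀ i, Fin (n i)) (hr : ∀ i ∈ MC, (r i : ℕ) = 0) (x : Idx n → ℝ) :
    q1LHS n a b MC r x = ∑ q, liftCoeff a b MC r q * x q := by
  rw [Fintype.sum_sigma, q1LHS, ← Finset.sum_subset (Finset.subset_univ MC)]
  · refine Finset.sum_congr rfl fun i hi => Finset.sum_congr rfl fun j _ => ?_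
    simp [liftCoeff, hi, hr i hi]
  · intro i _ hi
    simp [liftCoeff, hi]

/-- A point of `S` has at most one nonzero entry in each complementarity group. -/
lemma exists_eq_zero_of_mem_S {a : Idx n → ℝ} {b : ℝ} {x : Idx n → ℝ} (hx : x ∈ S n a b)
    (i : Fin m) (hi : 0 < n i) : ∃ j : Fin (n i), ∀ j' ≠ j, x ⟨i, j'⟩ = 0 := by
  by_cases h : ∃ j, x ⟨i, j⟩ ≠ 0
  · obtain ⟨j, hj⟩ := h
    exact ⟨j, fun j' hj' => (mul_eq_zero.mp (hx.2.2 i j' j hj')).resolve_right hj⟩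
  · push Not at h
    exact ⟨⟨0, hi⟩, fun j' _ => h j'⟩

/-- The lifted cover inequality is valid for the feasible set. -/
lemma sum_liftCoeff_mul_le (hn : ∀ i, 0 < n i) {a : Idx n → ℝ} {b : ℝ} (ha : ∀ q, 0 ≤ a q)
    {MC : Finset (Fin m)} {r : ∀ i, Fin (n i)}
    (hmax : ∀ i ∈ MC, ∀ j, a ⟨i, j⟩ ≤ a ⟨i, r i⟩)
    (hcover : b < ∑ i ∈ MC, a ⟨i, r i⟩) {x : Idx n → ℝ} (hx : x ∈ S n a b) :
    ∑ q, liftCoeff a b MC r q * x q ≤ b := by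
  have hsum : ∑ q, liftCoeff a b MC r q * x q
      = ∑ i ∈ MC, ∑ j, liftCoeff a b MC r ⟨i, j⟩ * x ⟨i, j⟩ := by
    rw [Fintype.sum_sigma, ← Finset.sum_subset (Finset.subset_univ MC)]
    intro i _ hi
    simp [liftCoeff, hi]
  rw [hsum]
  choose σ hσ using fun i => exists_eq_zero_of_mem_S hx i (hn i)
  have hgroup (c : Idx n → ℝ) (i : Fin m) : ∑ j, c ⟨i, j⟩ * x ⟨i, j⟩
      = c ⟨i, σ i⟩ * x ⟨i, σ i⟩ :=
    Fintype.sum_eq_single _ fun j hj => by rw [hσ i j hj, mul_zero]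
  simp only [hgroup]
  have hle (i) (hi : i ∈ MC) : liftCoeff a b MC r ⟨i, σ i⟩ ≤ a ⟨i, r i⟩ := by
    have := Finset.add_sum_erase MC (fun i => a ⟨i, r i⟩) hi
    simp only [liftCoeff, hi, if_true]
    exact max_le (hmax i hi _) (by linarith)
  by_cases h : ∃ i ∈ MC, a ⟨i, σ i⟩ < b - ∑ k ∈ MC.erase i, a ⟨k, r k⟩
  · obtain ⟨i, hi, hlt⟩ := h
    rw [← Finset.add_sum_erase MC _ hi]
    have h₁ : liftCoeff a b MC r ⟨i, σ i⟩ * x ⟨i, σ i⟩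
        ≤ b - ∑ k ∈ MC.erase i, a ⟨k, r k⟩ := by
      simp only [liftCoeff, hi, if_true, max_eq_right hlt.le]
      exact mul_le_of_le_one_right ((ha _).trans hlt.le) (hx.1 _).2
    have h₂ : ∑ k ∈ MC.erase i, liftCoeff a b MC r ⟨k, σ k⟩ * x ⟨k, σ k⟩
        ≤ ∑ k ∈ MC.erase i, a ⟨k, r k⟩ := by
      refine Finset.sum_le_sum fun k hk => ?_
      have hk := Finset.mem_of_mem_erase hk
      exact (mul_le_mul_of_nonneg_right (hle k hk) (hx.1 _).1).trans
        (mul_le_of_le_one_right (ha _) (hx.1 _).2)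
    linarith
  · push Not at h
    calc ∑ i ∈ MC, liftCoeff a b MC r ⟨i, σ i⟩ * x ⟨i, σ i⟩
        = ∑ i ∈ MC, ∑ j, a ⟨i, j⟩ * x ⟨i, j⟩ := by
          refine Finset.sum_congr rfl fun i hi => ?_
          rw [hgroup a i]
          simp only [liftCoeff, hi, if_true, max_eq_left (h i hi)]
      _ ≤ ∑ i, ∑ j, a ⟨i, j⟩ * x ⟨i, j⟩ :=
          Finset.sum_le_sum_of_subset_of_nonneg (Finset.subset_univ _) fun i _ _ =>
            Finset.sum_nonneg fun j _ => mul_nonneg (ha _) (hx.1 _).1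
      _ = ∑ q, a q * x q := (Fintype.sum_sigma fun q => a q * x q).symm
      _ ≤ b := hx.2.1

/-- The point with entry `1` at `(i, r i)` for `i ∈ T`, entry `s` at `p`, entry `u` at `q`, and
zeros elsewhere. -/
noncomputable def coverPoint (r : ∀ i, Fin (n i)) (T : Finset (Fin m)) (p : Idx n) (s : ℝ)
    (q : Idx n) (u : ℝ) : Idx n → ℝ :=
  ∑ i ∈ T, Pi.single ⟨i, r i⟩ 1 + s • Pi.single p 1 + u • Pi.single q 1

lemma map_coverPoint (f : (Idx n → ℝ) →ₗ[ℝ] ℝ) (r : ∀ i, Fin (n i)) (T : Finset (Fin m))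
    (p : Idx n) (s : ℝ) (q : Idx n) (u : ℝ) :
    f (coverPoint r T p s q u) =
      ∑ i ∈ T, f (Pi.single ⟨i, r i⟩ 1) + s * f (Pi.single p 1) + u * f (Pi.single q 1) := by
  simp [coverPoint]

lemma coverPoint_apply (r : ∀ i, Fin (n i)) (T : Finset (Fin m)) (p : Idx n) (s : ℝ)
    (q : Idx n) (u : ℝ) (i : Fin m) (j : Fin (n i)) :
    coverPoint r T p s q u ⟨i, j⟩ = (if i ∈ T ∧ j = r i then 1 else 0) +
      (if ⟨i, j⟩ = p then s else 0) + (if ⟨i, j⟩ = q then u else 0) := by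
  have hsum : ∑ k ∈ T, (Pi.single ⟨k, r k⟩ 1 : Idx n → ℝ) ⟨i, j⟩
      = if i ∈ T ∧ j = r i then 1 else 0 := by
    have hterm (k : Fin m) : (Pi.single ⟨k, r k⟩ 1 : Idx n → ℝ) ⟨i, j⟩
        = if i = k then (if j = r i then 1 else 0) else 0 := by
      rw [Pi.single_apply]
      by_cases hk : i = k
      · subst hk; simp
      · simp [hk]
    simp only [hterm, Finset.sum_ite_eq, ite_and]
  simp only [coverPoint, Pi.add_apply, Finset.sum_apply, hsum, Pi.smul_apply, smul_eq_mul]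
  simp only [Pi.single_apply, mul_ite, mul_one, mul_zero]

lemma coverPoint_mem_S {a : Idx n → ℝ} {b : ℝ} {r : ∀ i, Fin (n i)} {T : Finset (Fin m)}
    {p q : Idx n} {s u : ℝ} (hp : p.1 ∉ T) (hq : q.1 ∉ T) (hpq : p.1 ≠ q.1 ∨ u = 0)
    (hs₀ : 0 ≤ s) (hs₁ : s ≤ 1) (hu₀ : 0 ≤ u) (hu₁ : u ≤ 1)
    (hle : ∑ i ∈ T, a ⟨i, r i⟩ + s * a p + u * a q ≤ b) :
    coverPoint r T p s q u ∈ S n a b := by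
  obtain ⟨ip, jp⟩ := p
  obtain ⟨iq, jq⟩ := q
  refine ⟨?_, ?_, ?_⟩
  · rintro ⟨i, j⟩
    rw [coverPoint_apply, Set.mem_Icc]
    split_ifs <;> grind
  · have h := map_coverPoint (Fintype.linearCombination ℝ a) r T ⟨ip, jp⟩ s ⟨iq, jq⟩ u
    simp only [Fintype.linearCombination_apply_single, one_smul] at h
    rw [Fintype.linearCombination_apply] at h
    simp only [smul_eq_mul, mul_comm _ (a _)] at h
    linarith
  · intro i j j' hjj'
    rw [coverPoint_apply, coverPoint_apply]
    split_ifs <;> grind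

/-- A set lying in a hyperplane `f = δ` spans the hyperplane if every linear functional that is
constant on the set is a multiple of `f`. -/
lemma finrank_direction_affineSpan_of_forall_dual {V : Type*} [AddCommGroup V] [Module ℝ V]
    [FiniteDimensional ℝ V] {F : Set V} {f : V →ₗ[ℝ] ℝ} (hf : f ≠ 0) {δ : ℝ}
    (hF : ∀ x ∈ F, f x = δ)
    (h : ∀ g : V →ₗ[ℝ] ℝ, (∀ x ∈ F, ∀ y ∈ F, g x = g y) → ∃ c : ℝ, g = c • f) :
    Module.finrank ℝ (affineSpan ℝ F).direction = Module.finrank ℝ V - 1 := by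
  have hmem (g : V →ₗ[ℝ] ℝ) : g ∈ (affineSpan ℝ F).direction.dualAnnihilator ↔
      ∀ x ∈ F, ∀ y ∈ F, g x = g y := by
    rw [direction_affineSpan, vectorSpan_def, Submodule.mem_dualAnnihilator]
    constructor
    · intro hg x hx y hy
      have := hg (x - y) (Submodule.subset_span (Set.sub_mem_sub hx hy))
      rwa [map_sub, sub_eq_zero] at this
    · intro hg w hw
      induction hw using Submodule.span_induction with
      | mem w hw =>
        obtain ⟨x, hx, y, hy, rfl⟩ := hw
        simp [hg x hx y hy]
      | zero => simp
      | add _ _ _ _ h₁ h₂ => rw [map_add, h₁, h₂, add_zero]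
      | smul _ _ _ h₁ => rw [map_smul, h₁, smul_zero]
  have hann : (affineSpan ℝ F).direction.dualAnnihilator
      = Submodule.span ℝ {(f : Module.Dual ℝ V)} := by
    ext g
    rw [hmem, Submodule.mem_span_singleton]
    constructor
    · intro hg
      obtain ⟨c, rfl⟩ := h g hg
      exact ⟨c, rfl⟩
    · rintro ⟨c, rfl⟩ x hx y hy
      simp [hF x hx, hF y hy]
  have hdim := Subspace.finrank_add_finrank_dualAnnihilator_eq (affineSpan ℝ F).direction
  rw [hann, finrank_span_singleton (K := ℝ) hf] at hdim
  omega

/-- A functional that is constant on the feasible points satisfying the lifted cover inequality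
with equality is a multiple of its left-hand side. -/
lemma exists_eq_mul_liftCoeff_of_const {a : Idx n → ℝ} {b : ℝ} (ha : ∀ q, 0 ≤ a q)
    {MC : Finset (Fin m)} {r : ∀ i, Fin (n i)}
    (hmax : ∀ i ∈ MC, ∀ j, a ⟨i, j⟩ ≤ a ⟨i, r i⟩)
    (hcover : b < ∑ i ∈ MC, a ⟨i, r i⟩) {i' : Fin m} (hi' : i' ∈ MC) {j' : Fin (n i')}
    (hlift : (∑ i ∈ MC.erase i', a ⟨i, r i⟩) + a ⟨i', j'⟩ < b)
    {g : (Idx n → ℝ) →ₗ[ℝ] ℝ}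
    (hg : ∀ x ∈ S n a b, Fintype.linearCombination ℝ (liftCoeff a b MC r) x = b →
      ∀ y ∈ S n a b, Fintype.linearCombination ℝ (liftCoeff a b MC r) y = b → g x = g y) :
    ∃ c : ℝ, ∀ q, g (Pi.single q 1) = c * liftCoeff a b MC r q := by
  set α := liftCoeff a b MC r with hα
  set T := MC.erase i' with hT
  set t := b - ∑ i ∈ T, a ⟨i, r i⟩ with ht
  have hp₀ := ha ⟨i', j'⟩
  have ht₀ : 0 < t := by linarith
  have hpt : a ⟨i', j'⟩ < t := by linarith
  have hA : t < a ⟨i', r i'⟩ := by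
    have := Finset.add_sum_erase MC (fun i => a ⟨i, r i⟩) hi'
    linarith
  have hα' (j) : α ⟨i', j⟩ = max (a ⟨i', j⟩) t := by simp [hα, liftCoeff, hi', ht, hT]
  have hαr (k) (hk : k ∈ MC) : α ⟨k, r k⟩ = a ⟨k, r k⟩ := by
    have := Finset.add_sum_erase MC (fun i => a ⟨i, r i⟩) hk
    simp only [hα, liftCoeff, hk, if_true]
    exact max_eq_left (by linarith)
  have hαT (U : Finset (Fin m)) (hU : U ⊆ MC) :
      ∑ i ∈ U, α ⟨i, r i⟩ = ∑ i ∈ U, a ⟨i, r i⟩ :=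
    Finset.sum_congr rfl fun i hi => hαr i (hU hi)
  have hTMC : T ⊆ MC := Finset.erase_subset _ _
  have hi'T : i' ∉ T := Finset.notMem_erase _ _
  have hL (U : Finset (Fin m)) (p : Idx n) (s : ℝ) (q : Idx n) (u : ℝ) :
      Fintype.linearCombination ℝ α (coverPoint r U p s q u)
        = ∑ i ∈ U, α ⟨i, r i⟩ + s * α p + u * α q := by
    simp [map_coverPoint]
  have hbase_mem : coverPoint r T ⟨i', j'⟩ 1 ⟨i', j'⟩ 0 ∈ S n a b :=
    coverPoint_mem_S hi'T hi'T (Or.inr rfl) zero_le_one le_rfl le_rfl zero_le_one (by linarith)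
  have hbase_eq : Fintype.linearCombination ℝ α (coverPoint r T ⟨i', j'⟩ 1 ⟨i', j'⟩ 0) = b := by
    rw [hL, hαT T hTMC, hα', max_eq_right hpt.le]
    linarith
  have key (U : Finset (Fin m)) (p : Idx n) (s : ℝ) (q : Idx n) (u : ℝ)
      (hmem : coverPoint r U p s q u ∈ S n a b)
      (heq : ∑ i ∈ U, α ⟨i, r i⟩ + s * α p + u * α q = b) :
      ∑ i ∈ U, g (Pi.single ⟨i, r i⟩ 1) + s * g (Pi.single p 1) + u * g (Pi.single q 1)
        = ∑ i ∈ T, g (Pi.single ⟨i, r i⟩ 1) + g (Pi.single ⟨i', j'⟩ 1) := by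
    have := hg _ hmem (by rw [hL, heq]) _ hbase_mem hbase_eq
    rw [map_coverPoint, map_coverPoint] at this
    linarith
  set c := g (Pi.single ⟨i', j'⟩ 1) / t with hc
  have hct : g (Pi.single ⟨i', j'⟩ 1) = c * t := by rw [hc]; field_simp
  have hg' (j) : g (Pi.single ⟨i', j⟩ 1) = c * α ⟨i', j⟩ := by
    have hαt : t ≤ α ⟨i', j⟩ := by rw [hα']; exact le_max_right _ _
    have hαa : a ⟨i', j⟩ ≤ α ⟨i', j⟩ := by rw [hα']; exact le_max_left _ _
    have hα₀ : 0 < α ⟨i', j⟩ := ht₀.trans_le hαt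
    have hmul : t / α ⟨i', j⟩ * α ⟨i', j⟩ = t := by field_simp
    have hs₀ : 0 ≤ t / α ⟨i', j⟩ := by positivity
    have := mul_le_mul_of_nonneg_left hαa hs₀
    have hk := key T ⟨i', j⟩ (t / α ⟨i', j⟩) ⟨i', j⟩ 0
      (coverPoint_mem_S hi'T hi'T (Or.inr rfl) hs₀ ((div_le_one hα₀).mpr hαt) le_rfl zero_le_one
        (by linarith)) (by rw [hαT T hTMC, hmul]; linarith)
    have : t / α ⟨i', j⟩ * g (Pi.single ⟨i', j⟩ 1) = c * t := by linarith
    field_simp at this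
    linarith
  have hA₀ : 0 < a ⟨i', r i'⟩ := ht₀.trans hA
  have hB := hg' (r i')
  rw [hαr i' hi'] at hB
  have hgr (k) (hk : k ∈ T) : g (Pi.single ⟨k, r k⟩ 1) = c * a ⟨k, r k⟩ := by
    have hki : k ≠ i' := Finset.ne_of_mem_erase hk
    have hk₀ := ha ⟨k, r k⟩
    have hden : 0 < a ⟨i', r i'⟩ - t + a ⟨k, r k⟩ := by linarith
    obtain ⟨ε, hε₀, hε₁, hεle⟩ : ∃ ε : ℝ, 0 < ε ∧ ε ≤ 1 ∧
        ε * a ⟨k, r k⟩ ≤ a ⟨i', r i'⟩ - t := by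
      refine ⟨(a ⟨i', r i'⟩ - t) / (a ⟨i', r i'⟩ - t + a ⟨k, r k⟩),
        div_pos (by linarith) hden, (div_le_one hden).mpr (by linarith), ?_⟩
      rw [div_mul_eq_mul_div, div_le_iff₀ hden]
      exact mul_le_mul_of_nonneg_left (by linarith) (by linarith)
    have hεk := mul_nonneg hε₀.le hk₀
    set s := (t + ε * a ⟨k, r k⟩) / a ⟨i', r i'⟩ with hs
    have hsA : s * a ⟨i', r i'⟩ = t + ε * a ⟨k, r k⟩ := by rw [hs]; field_simp
    have hsumA := Finset.add_sum_erase T (fun i => a ⟨i, r i⟩) hk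
    have hsumB := Finset.add_sum_erase T (fun i => g (Pi.single ⟨i, r i⟩ 1)) hk
    have hkey := key (T.erase k) ⟨i', r i'⟩ s ⟨k, r k⟩ (1 - ε)
      (coverPoint_mem_S (fun h => hi'T (Finset.mem_of_mem_erase h)) (Finset.notMem_erase _ _)
        (Or.inl hki.symm) (by positivity) ((div_le_one hA₀).mpr (by linarith)) (by linarith)
        (by linarith) (by rw [hsA]; linarith))
      (by
        rw [hαT _ ((Finset.erase_subset _ _).trans hTMC), hαr i' hi', hαr k (hTMC hk), hsA]
        linarith)
    have hsB : s * g (Pi.single ⟨i', r i'⟩ 1) = c * (t + ε * a ⟨k, r k⟩) := by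
      rw [hB, ← hsA]; ring
    have : ε * g (Pi.single ⟨k, r k⟩ 1) = ε * (c * a ⟨k, r k⟩) := by linarith
    exact mul_left_cancel₀ hε₀.ne' this
  refine ⟨c, ?_⟩
  rintro ⟨k, j⟩
  have hq₀ := ha ⟨k, j⟩
  by_cases hk : k ∈ MC
  · by_cases hki : k = i'
    · subst hki
      exact hg' j
    have hkT : k ∈ T := Finset.mem_erase.mpr ⟨hki, hk⟩
    have hsumA := Finset.add_sum_erase T (fun i => a ⟨i, r i⟩) hkT
    have hsumB := Finset.add_sum_erase T (fun i => g (Pi.single ⟨i, r i⟩ 1)) hkT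
    have hMCi := Finset.add_sum_erase MC (fun i => a ⟨i, r i⟩) hi'
    have hMCk := Finset.add_sum_erase MC (fun i => a ⟨i, r i⟩) hk
    have hαq : α ⟨k, j⟩ = max (a ⟨k, j⟩) (b - ∑ l ∈ MC.erase k, a ⟨l, r l⟩) := by
      simp [hα, liftCoeff, hk]
    have hαa : a ⟨k, j⟩ ≤ α ⟨k, j⟩ := by rw [hαq]; exact le_max_left _ _
    have hαt : b - ∑ l ∈ MC.erase k, a ⟨l, r l⟩ ≤ α ⟨k, j⟩ := by
      rw [hαq]; exact le_max_right _ _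
    have hαle : α ⟨k, j⟩ ≤ a ⟨k, r k⟩ := by
      rw [hαq]; exact max_le (hmax k hk j) (by linarith)
    set s := (t + a ⟨k, r k⟩ - α ⟨k, j⟩) / a ⟨i', r i'⟩ with hs
    have hsA : s * a ⟨i', r i'⟩ = t + a ⟨k, r k⟩ - α ⟨k, j⟩ := by rw [hs]; field_simp
    have hkey := key (T.erase k) ⟨i', r i'⟩ s ⟨k, j⟩ 1
      (coverPoint_mem_S (fun h => hi'T (Finset.mem_of_mem_erase h)) (Finset.notMem_erase _ _)
        (Or.inl (Ne.symm hki)) (div_nonneg (by linarith) hA₀.le)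
        ((div_le_one hA₀).mpr (by linarith)) zero_le_one le_rfl (by rw [hsA]; linarith))
      (by
        rw [hαT _ ((Finset.erase_subset _ _).trans hTMC), hαr i' hi', hsA]
        linarith)
    have hsB : s * g (Pi.single ⟨i', r i'⟩ 1) = c * (t + a ⟨k, r k⟩ - α ⟨k, j⟩) := by
      rw [hB, ← hsA]; ring
    have := hgr k hkT
    linarith
  · have hαq : α ⟨k, j⟩ = 0 := by simp [hα, liftCoeff, hk]
    have hki : i' ≠ k := fun h => hk (h ▸ hi')
    have hden : 0 < t - a ⟨i', j'⟩ + a ⟨k, j⟩ := by linarith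
    obtain ⟨ε, hε₀, hε₁, hεle⟩ : ∃ ε : ℝ, 0 < ε ∧ ε ≤ 1 ∧
        ε * a ⟨k, j⟩ ≤ t - a ⟨i', j'⟩ := by
      refine ⟨(t - a ⟨i', j'⟩) / (t - a ⟨i', j'⟩ + a ⟨k, j⟩),
        div_pos (by linarith) hden, (div_le_one hden).mpr (by linarith), ?_⟩
      rw [div_mul_eq_mul_div, div_le_iff₀ hden]
      exact mul_le_mul_of_nonneg_left (by linarith) (by linarith)
    have hkey := key T ⟨i', j'⟩ 1 ⟨k, j⟩ ε
      (coverPoint_mem_S hi'T (fun h => hk (hTMC h)) (Or.inl hki) zero_le_one le_rfl hε₀.le hε₁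
        (by linarith))
      (by rw [hαT T hTMC, hα', max_eq_right hpt.le, hαq]; linarith)
    have : ε * g (Pi.single ⟨k, j⟩ 1) = 0 := by linarith
    rw [hαq, mul_zero]
    exact (mul_eq_zero.mp this).resolve_left hε₀.ne'

end CKP

/-- Theorem 3 in de Farias et al., facet case. If the cover
`C = {(i, r i) : i ∈ MC}` has `r i = 1` (0-based `0`) for all `i ∈ MC` and the lifting
condition holds, then the lifted cover inequality (q1) is facet-defining for `PS`. -/
theorem ckp_lifted_cover_ineq1_facet {m : ℕ} (n : Fin m → ℕ) (hn : ∀ i, 0 < n i)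
    (a : CKP.Idx n → ℝ) (b : ℝ)
    (ha : ∀ q : CKP.Idx n, 0 ≤ a q)
    (hmono : ∀ (i : Fin m) (j j' : Fin (n i)), (j : ℕ) ≤ (j' : ℕ) → a ⟨i, j'⟩ ≤ a ⟨i, j⟩)
    (hb : 0 < b)
    (hM : ∃ i, n i ≠ 1)
    (hbig : b < ∑ i : Fin m, a ⟨i, ⟨0, hn i⟩⟩)
    (MC : Finset (Fin m)) (r : ∀ i, Fin (n i))
    (hr : ∀ i ∈ MC, (r i : ℕ) = 0)
    (hcover : b < ∑ i ∈ MC, a ⟨i, r i⟩)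
    (i' : Fin m) (hi' : i' ∈ MC) (j' : Fin (n i'))
    (hrj : (r i' : ℕ) < (j' : ℕ))
    (hlift : (∑ i ∈ MC.erase i', a ⟨i, r i⟩) + a ⟨i', j'⟩ < b) :
    CKP.IsFacetDefining n a b (fun x => q1LHS n a b MC r x) b := by
  set L := Fintype.linearCombination ℝ (CKP.liftCoeff a b MC r) with hL
  have hLHS (x) : q1LHS n a b MC r x = L x := by
    rw [CKP.q1LHS_eq_sum_liftCoeff a b MC r hr, hL, Fintype.linearCombination_apply]
    simp only [smul_eq_mul, mul_comm]
  have hmax (i) (hi : i ∈ MC) (j) : a ⟨i, j⟩ ≤ a ⟨i, r i⟩ :=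
    hmono i _ _ (by rw [hr i hi]; exact Nat.zero_le _)
  refine ⟨fun x hx => ?_, ?_⟩
  · have hsub : CKP.S n a b ⊆ {x | L x ≤ b} := fun x hx => by
      rw [Set.mem_ofPred_eq, ← hLHS, CKP.q1LHS_eq_sum_liftCoeff a b MC r hr]
      exact CKP.sum_liftCoeff_mul_le hn ha hmax hcover hx
    exact (hLHS x).trans_le (convexHull_min hsub (convex_halfSpace_le L.isLinear b) hx)
  · rw [← Module.finrank_fintype_fun_eq_card (R := ℝ) (η := CKP.Idx n)]
    refine CKP.finrank_direction_affineSpan_of_forall_dual (f := L) (δ := b) ?_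
      (fun x hx => (hLHS x).symm.trans hx.2) ?_
    · intro h
      have h₁ : L (Pi.single ⟨i', j'⟩ 1) = 0 := by rw [h, LinearMap.zero_apply]
      rw [hL, Fintype.linearCombination_apply_single, one_smul] at h₁
      have h₂ := le_max_right (a ⟨i', j'⟩) (b - ∑ k ∈ MC.erase i', a ⟨k, r k⟩)
      have h₃ := ha ⟨i', j'⟩
      simp only [CKP.liftCoeff, hi', if_true] at h₁
      linarith
    · intro g hg
      obtain ⟨c, hc⟩ := CKP.exists_eq_mul_liftCoeff_of_const ha hmax hcover hi' hlift
        (g := g) fun x hx hxb y hy hyb =>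
          hg x ⟨subset_convexHull ℝ _ hx, (hLHS x).trans hxb⟩
            y ⟨subset_convexHull ℝ _ hy, (hLHS y).trans hyb⟩
      refine ⟨c, LinearMap.pi_ext' fun q => LinearMap.ext_ring ?_⟩
      simp [hc, hL, Fintype.linearCombination_apply_single]
end

section
/- Let C ⊆ I be a cover and (i',j') ∈ C with j' < n_{i'}; denote the elements of C other than (i',j') by (i, t_i) for i ∈ M_C, i ≠ i'. Suppose ∑_{i∈M_C, i≠i'} a_{i t_i} + a_{i' n_{i'}} < b. Then every x ∈ S (hence every x ∈ PS) satisfies ∑_{j∈N_{i'}} max{ a_{i'j}, b − ∑_{k∈M_C, k≠i'} a_{k t_k} } x_{i'j} + ∑_{i∈M_C, i≠i'} ( ∑_{j=1}^{t_i} a_{i t_i} · max{ 1, a_{ij} / (b − ∑_{k∈M_C, k∉{i,i'}} a_{k t_k} − a_{i' n_{i'}}) } x_{ij} + ∑_{j=t_i+1}^{n_i} a_{ij} x_{ij} ) ≤ b. -/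
open Finset

/-- Left-hand side of the lifted cover inequality (4)/(q2), for the cover
`C = {(i, t i) : i ∈ MC, i ≠ i'} ∪ {(i', j')}` (indices are 0-based). -/
noncomputable def q2LHS {m : ℕ} (n : Fin m → ℕ) (hn : ∀ i, 0 < n i) (a : CKP.Idx n → ℝ) (b : ℝ)
    (MC : Finset (Fin m)) (i' : Fin m) (t : ∀ i, Fin (n i)) (x : CKP.Idx n → ℝ) : ℝ :=
  (∑ j : Fin (n i'), max (a ⟨i', j⟩) (b - ∑ k ∈ MC.erase i', a ⟨k, t k⟩) * x ⟨i', j⟩)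
  + ∑ i ∈ MC.erase i', ∑ j : Fin (n i),
      (if (j : ℕ) ≤ (t i : ℕ)
       then a ⟨i, t i⟩ * max 1 (a ⟨i, j⟩ /
            (b - (∑ k ∈ (MC.erase i').erase i, a ⟨k, t k⟩)
               - a ⟨i', ⟨n i' - 1, Nat.sub_lt (hn i') Nat.one_pos⟩⟩))
       else a ⟨i, j⟩) * x ⟨i, j⟩

/-- Every row of a feasible point has at most one nonzero entry. -/
lemma CKP.exists_support {m : ℕ} {n : Fin m → ℕ} {a : CKP.Idx n → ℝ} {b : ℝ}
    {x : CKP.Idx n → ℝ} (hx : x ∈ CKP.S n a b) (i : Fin m) (hi : 0 < n i) :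
    ∃ j₀ : Fin (n i), ∀ j, j ≠ j₀ → x ⟨i, j⟩ = 0 := by
  by_cases h : ∃ j₀ : Fin (n i), x ⟨i, j₀⟩ ≠ 0
  · obtain ⟨j₀, h₀⟩ := h
    exact ⟨j₀, fun j hj => (mul_eq_zero.mp (hx.2.2 i j j₀ hj)).resolve_right h₀⟩
  · push Not at h
    exact ⟨⟨0, hi⟩, fun j _ => h j⟩

/-- A lifted coefficient never exceeds the knapsack coefficient, and the lifted term either stays
below `c` or leaves a gap of at least `δ`. -/
lemma lifted_term_bounds {c δ u x : ℝ} (hc : 0 ≤ c) (hδ : 0 < δ) (hcu : c ≤ u)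
    (hx0 : 0 ≤ x) (hx1 : x ≤ 1) :
    c * max 1 (u / (c + δ)) * x ≤ u * x ∧
      (c * max 1 (u / (c + δ)) * x ≤ c ∨ c * max 1 (u / (c + δ)) * x + δ ≤ u * x) := by
  have hD : 0 < c + δ := by linarith
  rcases le_total (u / (c + δ)) 1 with h | h
  · rw [max_eq_left h, mul_one]
    exact ⟨mul_le_mul_of_nonneg_right hcu hx0, Or.inl (mul_le_of_le_one_right hc hx1)⟩
  · rw [max_eq_right h]
    have hu : u / (c + δ) * (c + δ) = u := div_mul_cancel₀ _ hD.ne'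
    set r := u / (c + δ)
    have hrx : 0 ≤ r * x := mul_nonneg (by linarith) hx0
    have e : u * x = c * r * x + δ * (r * x) := by rw [← hu]; ring
    refine ⟨by rw [e]; nlinarith, ?_⟩
    rcases le_total (r * x) 1 with h1 | h1
    · left; nlinarith
    · right; rw [e]; nlinarith

/-- If every term `β i` is at most `w i`, and is at most `c i` or has a gap of `δ` below `w i`,
then the lifted inequality follows from the knapsack inequality. -/
lemma max_mul_add_sum_le {ι : Type*} (s : Finset ι) (β w c : ι → ℝ) {b α p y : ℝ}
    (hα : 0 ≤ α) (hαp : α ≤ p) (hy1 : y ≤ 1)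
    (hδ : ∑ i ∈ s, c i + α < b)
    (hβw : ∀ i ∈ s, β i ≤ w i)
    (hβ : ∀ i ∈ s, β i ≤ c i ∨ β i + (b - ∑ k ∈ s, c k - α) ≤ w i)
    (hw : p * y + ∑ i ∈ s, w i ≤ b) :
    max p (b - ∑ k ∈ s, c k) * y + ∑ i ∈ s, β i ≤ b := by
  have hsum := Finset.sum_le_sum hβw
  rcases le_total (b - ∑ k ∈ s, c k) p with h | h
  · rw [max_eq_left h]
    linarith
  · rw [max_eq_right h]
    by_cases hall : ∀ i ∈ s, β i ≤ c i
    · have := Finset.sum_le_sum hall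
      nlinarith
    · push Not at hall
      obtain ⟨i, hi, hci⟩ := hall
      have hgap := (hβ i hi).resolve_left (not_le.mpr hci)
      have hdiff : w i - β i ≤ ∑ k ∈ s, (w k - β k) :=
        Finset.single_le_sum (f := fun k => w k - β k)
          (fun k hk => sub_nonneg.mpr (hβw k hk)) hi
      rw [Finset.sum_sub_distrib] at hdiff
      nlinarith [mul_nonneg (sub_nonneg.mpr h) (sub_nonneg.mpr hy1)]

lemma isLinearMap_q2LHS {m : ℕ} (n : Fin m → ℕ) (hn : ∀ i, 0 < n i) (a : CKP.Idx n → ℝ) (b : ℝ)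
    (MC : Finset (Fin m)) (i' : Fin m) (t : ∀ i, Fin (n i)) :
    IsLinearMap ℝ (q2LHS n hn a b MC i' t) where
  map_add x y := by
    simp only [q2LHS, Pi.add_apply, mul_add, Finset.sum_add_distrib]
    ring
  map_smul r x := by
    simp only [q2LHS, Pi.smul_apply, smul_eq_mul, mul_add, Finset.mul_sum, mul_left_comm r]

/-- Theorem 4 in de Farias et al., validity. Let
`C = {(i, t i) : i ∈ MC, i ≠ i'} ∪ {(i', j')}` be a cover with `j' < n i'`
(0-based: `j' + 1 < n i'`) and `∑_{i ∈ M_C, i ≠ i'} a_{i t_i} + a_{i' n_{i'}} < b`.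
Then the lifted cover inequality (q2) is valid for every point of `PS` (in particular
for every point of `S ⊆ PS`). -/
theorem ckp_lifted_cover_ineq2_valid {m : ℕ} (n : Fin m → ℕ) (hn : ∀ i, 0 < n i)
    (a : CKP.Idx n → ℝ) (b : ℝ)
    (ha : ∀ q : CKP.Idx n, 0 ≤ a q)
    (hmono : ∀ (i : Fin m) (j j' : Fin (n i)), (j : ℕ) ≤ (j' : ℕ) → a ⟨i, j'⟩ ≤ a ⟨i, j⟩)
    (hb : 0 < b)
    (hM : ∃ i, n i ≠ 1)
    (hbig : b < ∑ i : Fin m, a ⟨i, ⟨0, hn i⟩⟩)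
    (MC : Finset (Fin m)) (i' : Fin m) (hi' : i' ∈ MC)
    (j' : Fin (n i')) (hj' : (j' : ℕ) + 1 < n i')
    (t : ∀ i, Fin (n i))
    (hcover : b < (∑ i ∈ MC.erase i', a ⟨i, t i⟩) + a ⟨i', j'⟩)
    (hcond : (∑ i ∈ MC.erase i', a ⟨i, t i⟩)
        + a ⟨i', ⟨n i' - 1, Nat.sub_lt (hn i') Nat.one_pos⟩⟩ < b)
    (x : CKP.Idx n → ℝ) (hx : x ∈ CKP.PS n a b) :
    q2LHS n hn a b MC i' t x ≤ b := by
  refine convexHull_min (t := {x | q2LHS n hn a b MC i' t x ≤ b}) ?_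
    (convex_halfSpace_le (isLinearMap_q2LHS n hn a b MC i' t) b) hx
  intro x hx
  choose s hs using fun i => CKP.exists_support hx i (hn i)
  have row (i : Fin m) (f : Fin (n i) → ℝ) :
      ∑ j, f j * x ⟨i, j⟩ = f (s i) * x ⟨i, s i⟩ :=
    Finset.sum_eq_single_of_mem _ (Finset.mem_univ _)
      fun j _ hj => by rw [hs i j hj, mul_zero]
  have hx01 (q : CKP.Idx n) : 0 ≤ x q ∧ x q ≤ 1 := hx.1 q
  have hknap : a ⟨i', s i'⟩ * x ⟨i', s i'⟩
      + ∑ i ∈ MC.erase i', a ⟨i, s i⟩ * x ⟨i, s i⟩ ≤ b := by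
    rw [Finset.add_sum_erase MC (fun i => a ⟨i, s i⟩ * x ⟨i, s i⟩) hi']
    refine le_trans ?_ hx.2.1
    rw [Fintype.sum_sigma]
    simp only [row _ (fun j => a ⟨_, j⟩)]
    exact Finset.sum_le_sum_of_subset_of_nonneg (Finset.subset_univ _)
      fun i _ _ => mul_nonneg (ha _) (hx01 _).1
  set α := a ⟨i', ⟨n i' - 1, Nat.sub_lt (hn i') Nat.one_pos⟩⟩
  set δ := b - ∑ k ∈ MC.erase i', a ⟨k, t k⟩ - α with hδ
  have hδpos : 0 < δ := by linarith
  have hterm : ∀ i ∈ MC.erase i',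
      (if (s i : ℕ) ≤ (t i : ℕ)
        then a ⟨i, t i⟩ * max 1 (a ⟨i, s i⟩ /
          (b - (∑ k ∈ (MC.erase i').erase i, a ⟨k, t k⟩) - α))
        else a ⟨i, s i⟩) * x ⟨i, s i⟩ ≤ a ⟨i, s i⟩ * x ⟨i, s i⟩ ∧
      ((if (s i : ℕ) ≤ (t i : ℕ)
        then a ⟨i, t i⟩ * max 1 (a ⟨i, s i⟩ /
          (b - (∑ k ∈ (MC.erase i').erase i, a ⟨k, t k⟩) - α))
        else a ⟨i, s i⟩) * x ⟨i, s i⟩ ≤ a ⟨i, t i⟩ ∨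
      (if (s i : ℕ) ≤ (t i : ℕ)
        then a ⟨i, t i⟩ * max 1 (a ⟨i, s i⟩ /
          (b - (∑ k ∈ (MC.erase i').erase i, a ⟨k, t k⟩) - α))
        else a ⟨i, s i⟩) * x ⟨i, s i⟩ + δ ≤ a ⟨i, s i⟩ * x ⟨i, s i⟩) := by
    intro i hi
    have hD : b - (∑ k ∈ (MC.erase i').erase i, a ⟨k, t k⟩) - α = a ⟨i, t i⟩ + δ := by
      have := Finset.add_sum_erase (MC.erase i') (fun k => a ⟨k, t k⟩) hi
      linarith
    rw [hD]
    split_ifs with h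
    · exact lifted_term_bounds (ha _) hδpos (hmono i _ _ h) (hx01 _).1 (hx01 _).2
    · exact ⟨le_rfl, Or.inl ((mul_le_of_le_one_right (ha _) (hx01 _).2).trans
        (hmono i _ _ (not_le.mp h).le))⟩
  change q2LHS n hn a b MC i' t x ≤ b
  unfold q2LHS
  simp only [row i' (fun j => max (a ⟨i', j⟩) (b - ∑ k ∈ MC.erase i', a ⟨k, t k⟩)),
    row _ (fun j => if (j : ℕ) ≤ (t _ : ℕ) then _ else a ⟨_, j⟩)]
  exact max_mul_add_sum_le _ _ (fun i => a ⟨i, s i⟩ * x ⟨i, s i⟩) (fun k => a ⟨k, t k⟩)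
    (ha _) (hmono i' _ _ (Nat.le_sub_one_of_lt (s i').isLt)) (hx01 _).2 hcond
    (fun i hi => (hterm i hi).1) (fun i hi => (hterm i hi).2) hknap
end

section
/- Let C ⊆ I be a cover and (i',j') ∈ C with j' < n_{i'}, such that every element of C other than (i',j') is of the form (i, n_i), and suppose ∑_{i∈M_C, i≠i'} a_{i n_i} + a_{i' n_{i'}} < b. Then the inequality ∑_{j∈N_{i'}} max{ a_{i'j}, b − ∑_{k∈M_C, k≠i'} a_{k n_k} } x_{i'j} + ∑_{i∈M_C, i≠i'} ∑_{j=1}^{n_i} a_{i n_i} · max{ 1, a_{ij} / (b − ∑_{k∈M_C, k∉{i,i'}} a_{k n_k} − a_{i' n_{i'}}) } x_{ij} ≤ b is facet-defining for PS. -/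
open Finset

/-- If a set in a hyperplane avoiding the origin spans the whole space, then its affine span
has codimension one. -/
theorem finrank_direction_of_span_eq_top {ι : Type*} [Fintype ι] {F : Set (ι → ℝ)}
    (φ : (ι → ℝ) →ₗ[ℝ] ℝ) {δ : ℝ} (hδ : δ ≠ 0) (hF : ∀ x ∈ F, φ x = δ) (hne : F.Nonempty)
    (hspan : Submodule.span ℝ F = ⊤) :
    Module.finrank ℝ (affineSpan ℝ F).direction = Fintype.card ι - 1 := by
  obtain ⟨p, hp⟩ := hne
  have hle : (affineSpan ℝ F).direction ≤ LinearMap.ker φ := by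
    rw [direction_affineSpan, vectorSpan_def, Submodule.span_le]
    rintro _ ⟨x, hx, y, hy, rfl⟩
    simp [hF x hx, hF y hy]
  have htop : (affineSpan ℝ F).direction ⊔ Submodule.span ℝ {p} = ⊤ := by
    rw [eq_top_iff, ← hspan, Submodule.span_le]
    intro x hx
    refine Submodule.mem_sup.2 ⟨x - p, ?_, p, Submodule.mem_span_singleton_self p, by simp⟩
    rw [direction_affineSpan]
    exact vsub_mem_vectorSpan ℝ hx hp
  have hge : LinearMap.ker φ ≤ (affineSpan ℝ F).direction := by
    intro x hx
    obtain ⟨v, hv, w, hw, rfl⟩ := Submodule.mem_sup.1 (htop ▸ Submodule.mem_top : x ∈ _)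
    obtain ⟨c, rfl⟩ := Submodule.mem_span_singleton.1 hw
    have h1 := LinearMap.mem_ker.1 (hle hv)
    have h2 := LinearMap.mem_ker.1 hx
    rw [map_add, h1, map_smul, hF p hp] at h2
    have : c = 0 := by simpa [hδ] using h2
    simpa [this] using hv
  have hsurj : LinearMap.range φ = ⊤ :=
    LinearMap.range_eq_top.2 (LinearMap.surjective (fun h => hδ (by rw [← hF p hp, h]; rfl)))
  have := LinearMap.finrank_range_add_finrank_ker φ
  rw [hsurj, finrank_top, Module.finrank_self, Module.finrank_fintype_fun_eq_card] at this
  rw [le_antisymm hle hge]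
  omega

/-- Validity of the lifted cover inequality for a point with at most one nonzero entry per
group: `y'` is the entry of the distinguished group, with weight `v`, and `y k` the entry of
group `k`, with weight `u k`. -/
theorem lifted_cover_valid {ι : Type*} (K : Finset ι) (α u y : ι → ℝ) {c r v y' : ℝ}
    (hcr : c < r) (hα : ∀ k ∈ K, 0 ≤ α k) (hu : ∀ k ∈ K, α k ≤ u k)
    (hy : ∀ k ∈ K, y k ∈ Set.Icc (0 : ℝ) 1) (hy' : y' ∈ Set.Icc (0 : ℝ) 1) (hr : 0 ≤ r)
    (hv : c ≤ v) (hknap : v * y' + ∑ k ∈ K, u k * y k ≤ r + ∑ k ∈ K, α k) :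
    max v r * y' + ∑ k ∈ K, α k * max 1 (u k / (r - c + α k)) * y k ≤ r + ∑ k ∈ K, α k := by
  have hD : ∀ k ∈ K, 0 < r - c + α k := fun k hk => by linarith [hα k hk]
  have hquot : ∀ k ∈ K, α k * (u k / (r - c + α k)) = u k - (r - c) * (u k / (r - c + α k)) := by
    intro k hk
    have := (hD k hk).ne'
    field_simp
    ring
  have hquot0 : ∀ k ∈ K, 0 ≤ u k / (r - c + α k) := fun k hk =>
    div_nonneg ((hα k hk).trans (hu k hk)) (hD k hk).le
  rcases le_total r v with hrv | hrv
  · rw [max_eq_left hrv]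
    refine le_trans ?_ hknap
    gcongr with k hk
    · exact (hy k hk).1
    · rcases le_total (u k / (r - c + α k)) 1 with h | h
      · rw [max_eq_left h, mul_one]
        exact hu k hk
      · rw [max_eq_right h, hquot k hk]
        nlinarith [hquot0 k hk]
  rw [max_eq_right hrv]
  set z : ι → ℝ := fun k =>
    if 1 ≤ u k / (r - c + α k) then u k / (r - c + α k) * y k else 0 with hz
  have hz0 : ∀ k ∈ K, 0 ≤ z k := by
    intro k hk
    simp only [hz]
    split_ifs
    · exact mul_nonneg (hquot0 k hk) (hy k hk).1
    · exact le_rfl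
  rcases le_total y' (∑ k ∈ K, z k) with hle | hle
  · have hterm : ∑ k ∈ K, α k * max 1 (u k / (r - c + α k)) * y k ≤
        ∑ k ∈ K, (u k * y k - (r - c) * z k) := by
      refine Finset.sum_le_sum fun k hk => ?_
      simp only [hz]
      split_ifs with h
      · rw [max_eq_right h, hquot k hk]
        linarith
      · rw [max_eq_left (not_le.1 h).le]
        nlinarith [hu k hk, (hy k hk).1]
    rw [Finset.sum_sub_distrib, ← Finset.mul_sum] at hterm
    nlinarith [hy'.1]
  · have hterm : ∑ k ∈ K, α k * max 1 (u k / (r - c + α k)) * y k ≤ ∑ k ∈ K, α k := by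
      refine Finset.sum_le_sum fun k hk => ?_
      rw [mul_assoc]
      refine mul_le_of_le_one_right (hα k hk) ?_
      rcases le_total 1 (u k / (r - c + α k)) with h | h
      · have h1 := (Finset.single_le_sum hz0 hk).trans (hle.trans hy'.2)
        simp only [hz, if_pos h] at h1
        rwa [max_eq_right h]
      · rw [max_eq_left h, one_mul]
        exact (hy k hk).2
    nlinarith [hy'.2]

namespace CKP

variable {m : ℕ} {n : Fin m → ℕ}

/-- The point whose only possibly nonzero entry in group `i` is `y i`, in position `j i`. -/
def selPoint (j : ∀ i, Fin (n i)) (y : Fin m → ℝ) : Idx n → ℝ :=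
  fun q => if q.2 = j q.1 then y q.1 else 0

theorem sum_mul_selPoint (g : Idx n → ℝ) (j : ∀ i, Fin (n i)) (y : Fin m → ℝ) :
    ∑ q, g q * selPoint j y q = ∑ i, g ⟨i, j i⟩ * y i := by
  simp [Fintype.sum_sigma, selPoint]

theorem selPoint_eq_sum (j : ∀ i, Fin (n i)) (y : Fin m → ℝ) :
    selPoint j y = ∑ i, y i • (Pi.single ⟨i, j i⟩ 1 : Idx n → ℝ) := by
  ext ⟨i, l⟩
  rw [Finset.sum_apply, Finset.sum_eq_single i]
  · by_cases h : l = j i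
    · subst h
      simp [selPoint]
    · simp [selPoint, h]
  · intro k _ hk
    have : (⟨i, l⟩ : Idx n) ≠ ⟨k, j k⟩ := fun h => hk (congrArg Sigma.fst h).symm
    simp [this]
  · simp

theorem selPoint_mem_S {a : Idx n → ℝ} {b : ℝ} {j : ∀ i, Fin (n i)} {y : Fin m → ℝ}
    (hy : ∀ i, y i ∈ Set.Icc (0 : ℝ) 1) (hknap : ∑ i, a ⟨i, j i⟩ * y i ≤ b) :
    selPoint j y ∈ S n a b := by
  refine ⟨fun q => ?_, by rwa [sum_mul_selPoint], fun i l l' hl => ?_⟩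
  · unfold selPoint
    split_ifs
    · exact hy _
    · simp
  · by_cases h : l = j i
    · have : l' ≠ j i := fun h' => hl (h.trans h'.symm)
      simp [selPoint, this]
    · simp [selPoint, h]

theorem exists_selPoint_of_mem_S (hn : ∀ i, 0 < n i) {a : Idx n → ℝ} {b : ℝ} {x : Idx n → ℝ}
    (hx : x ∈ S n a b) :
    ∃ (j : ∀ i, Fin (n i)) (y : Fin m → ℝ), (∀ i, y i ∈ Set.Icc (0 : ℝ) 1) ∧
      x = selPoint j y := by
  obtain ⟨h01, -, hcomp⟩ := hx
  have : ∀ i, ∃ l : Fin (n i), ∀ l', l' ≠ l → x ⟨i, l'⟩ = 0 := by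
    intro i
    by_cases h : ∃ l, x ⟨i, l⟩ ≠ 0
    · obtain ⟨l, hl⟩ := h
      exact ⟨l, fun l' hl' => (mul_eq_zero.1 (hcomp i l' l hl')).resolve_right hl⟩
    · push Not at h
      exact ⟨⟨0, hn i⟩, fun l' _ => h l'⟩
  choose j hj using this
  refine ⟨j, fun i => x ⟨i, j i⟩, fun i => h01 _, ?_⟩
  ext ⟨i, l⟩
  by_cases h : l = j i
  · subst h
    simp [selPoint]
  · simp [selPoint, h, hj i l h]

/-- A linear functional is bounded on `PS` as soon as it is bounded on the selection points
of `S`. -/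
theorem sum_mul_le_of_mem_PS (hn : ∀ i, 0 < n i) {a g : Idx n → ℝ} {b δ : ℝ}
    (h : ∀ (j : ∀ i, Fin (n i)) (y : Fin m → ℝ), (∀ i, y i ∈ Set.Icc (0 : ℝ) 1) →
      ∑ i, a ⟨i, j i⟩ * y i ≤ b → ∑ i, g ⟨i, j i⟩ * y i ≤ δ)
    {x : Idx n → ℝ} (hx : x ∈ PS n a b) : ∑ q, g q * x q ≤ δ := by
  have hconv : Convex ℝ {x : Idx n → ℝ | ∑ q, g q * x q ≤ δ} := by
    refine convex_halfSpace_le ⟨fun x y => ?_, fun c x => ?_⟩ δ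
    · simp [mul_add, Finset.sum_add_distrib]
    · simp only [Pi.smul_apply, smul_eq_mul, Finset.mul_sum]
      exact Finset.sum_congr rfl fun q _ => by ring
  refine convexHull_min (fun x hx => ?_) hconv hx
  obtain ⟨j, y, hy, rfl⟩ := exists_selPoint_of_mem_S hn hx
  have hk := hx.2.1
  rw [sum_mul_selPoint] at hk
  rw [Set.mem_ofPred_eq, sum_mul_selPoint]
  exact h j y hy hk

theorem selPoint_mem_span_face {a g : Idx n → ℝ} {b δ : ℝ} {j : ∀ i, Fin (n i)}
    {y : Fin m → ℝ} (hy : ∀ i, y i ∈ Set.Icc (0 : ℝ) 1) (hknap : ∑ i, a ⟨i, j i⟩ * y i ≤ b)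
    (hg : ∑ i, g ⟨i, j i⟩ * y i = δ) :
    ∑ i, y i • (Pi.single ⟨i, j i⟩ 1 : Idx n → ℝ) ∈
      Submodule.span ℝ {x ∈ PS n a b | ∑ q, g q * x q = δ} := by
  rw [← selPoint_eq_sum]
  exact Submodule.subset_span
    ⟨subset_convexHull ℝ _ (selPoint_mem_S hy hknap), by rw [sum_mul_selPoint, hg]⟩

theorem sum_eq_add_sum_of_eq_zero {β : Type*} [AddCommMonoid β] {K : Finset (Fin m)} {i' : Fin m}
    (hK : i' ∉ K) {h : Fin m → β} (h0 : ∀ i, i ≠ i' → i ∉ K → h i = 0) :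
    ∑ i, h i = h i' + ∑ i ∈ K, h i := by
  rw [← Finset.sum_insert hK]
  refine (Finset.sum_subset (Finset.subset_univ _) fun i _ hi => ?_).symm
  rw [Finset.mem_insert, not_or] at hi
  exact h0 i hi.1 hi.2

/-- Points with value `s` at `⟨i', l⟩` and `1` at `⟨k, t k⟩` for `k ∈ K`. -/
theorem single_add_sum_mem_span_face {a g : Idx n → ℝ} {b δ : ℝ} {K : Finset (Fin m)}
    {i' : Fin m} (hK : i' ∉ K) (t : ∀ i, Fin (n i)) (l : Fin (n i')) {s : ℝ}
    (hs : s ∈ Set.Icc (0 : ℝ) 1) (hknap : a ⟨i', l⟩ * s + ∑ k ∈ K, a ⟨k, t k⟩ ≤ b)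
    (hg : g ⟨i', l⟩ * s + ∑ k ∈ K, g ⟨k, t k⟩ = δ) :
    s • (Pi.single ⟨i', l⟩ 1 : Idx n → ℝ) + ∑ k ∈ K, (Pi.single ⟨k, t k⟩ 1 : Idx n → ℝ) ∈
      Submodule.span ℝ {x ∈ PS n a b | ∑ q, g q * x q = δ} := by
  set y : Fin m → ℝ := fun i => if i = i' then s else if i ∈ K then 1 else 0 with hy
  have hne : ∀ k ∈ K, k ≠ i' := fun k hk h => hK (h ▸ hk)
  have hyK : ∀ k ∈ K, y k = 1 := fun k hk => by simp [hy, hne k hk, hk]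
  have hy0 : ∀ i, i ≠ i' → i ∉ K → y i = 0 := fun i h1 h2 => by simp [hy, h1, h2]
  have hsum : ∀ f : Idx n → ℝ, ∑ i, f ⟨i, Function.update t i' l i⟩ * y i =
      f ⟨i', l⟩ * s + ∑ k ∈ K, f ⟨k, t k⟩ := by
    intro f
    rw [sum_eq_add_sum_of_eq_zero hK fun i h1 h2 => by rw [hy0 i h1 h2, mul_zero]]
    congr 1
    · simp [hy]
    · exact Finset.sum_congr rfl fun k hk => by
        rw [hyK k hk, mul_one, Function.update_of_ne (hne k hk)]
  have := selPoint_mem_span_face (a := a) (g := g) (b := b) (δ := δ)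
    (j := Function.update t i' l) (y := y) (fun i => ?_) (by rwa [hsum]) (by rwa [hsum])
  · rw [sum_eq_add_sum_of_eq_zero hK fun i h1 h2 => by rw [hy0 i h1 h2, zero_smul]] at this
    convert this using 2
    · simp [hy]
    · exact Finset.sum_congr rfl fun k hk => by
        rw [hyK k hk, one_smul, Function.update_of_ne (hne k hk)]
  · simp only [hy]
    split_ifs
    · exact hs
    · simp
    · simp

/-- Points with value `s` at `⟨i', l⟩`, `s₀` at `⟨k₀, l₀⟩` and `1` at `⟨k, t k⟩` for the
other `k ∈ K`. -/
theorem single_add_single_add_sum_mem_span_face {a g : Idx n → ℝ} {b δ : ℝ}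
    {K : Finset (Fin m)} {i' : Fin m} (hK : i' ∉ K) (t : ∀ i, Fin (n i)) (l : Fin (n i'))
    {k₀ : Fin m} (hk₀ : k₀ ≠ i') (l₀ : Fin (n k₀)) {s s₀ : ℝ}
    (hs : s ∈ Set.Icc (0 : ℝ) 1) (hs₀ : s₀ ∈ Set.Icc (0 : ℝ) 1)
    (hknap : a ⟨i', l⟩ * s + (a ⟨k₀, l₀⟩ * s₀ + ∑ k ∈ K.erase k₀, a ⟨k, t k⟩) ≤ b)
    (hg : g ⟨i', l⟩ * s + (g ⟨k₀, l₀⟩ * s₀ + ∑ k ∈ K.erase k₀, g ⟨k, t k⟩) = δ) :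
    s • (Pi.single ⟨i', l⟩ 1 : Idx n → ℝ) + (s₀ • (Pi.single ⟨k₀, l₀⟩ 1 : Idx n → ℝ) +
      ∑ k ∈ K.erase k₀, (Pi.single ⟨k, t k⟩ 1 : Idx n → ℝ)) ∈
      Submodule.span ℝ {x ∈ PS n a b | ∑ q, g q * x q = δ} := by
  set j : ∀ i, Fin (n i) := Function.update (Function.update t i' l) k₀ l₀ with hj
  set y : Fin m → ℝ := fun i =>
    if i = i' then s else if i = k₀ then s₀ else if i ∈ K then 1 else 0 with hy
  have hne : ∀ k ∈ K.erase k₀, k ≠ i' := fun k hk h => hK (h ▸ Finset.mem_of_mem_erase hk)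
  have hyi : y i' = s := by simp [hy]
  have hyk : y k₀ = s₀ := by simp [hy, hk₀]
  have hji : j i' = l := by simp [hj, hk₀.symm]
  have hjk : j k₀ = l₀ := by simp [hj]
  have hyK : ∀ k ∈ K.erase k₀, y k = 1 := fun k hk => by
    simp [hy, hne k hk, Finset.ne_of_mem_erase hk, Finset.mem_of_mem_erase hk]
  have hjK : ∀ k ∈ K.erase k₀, j k = t k := fun k hk => by
    simp [hj, hne k hk, Finset.ne_of_mem_erase hk]
  have hi : i' ∉ insert k₀ (K.erase k₀) := by simp [hK, hk₀.symm]
  have hy0 : ∀ i, i ≠ i' → i ∉ insert k₀ (K.erase k₀) → y i = 0 := by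
    intro i h1 h2
    simp only [Finset.mem_insert, Finset.mem_erase, not_or, not_and] at h2
    simp [hy, h1, h2.1, h2.2 h2.1]
  have hsum : ∀ f : Idx n → ℝ, ∑ i, f ⟨i, j i⟩ * y i =
      f ⟨i', l⟩ * s + (f ⟨k₀, l₀⟩ * s₀ + ∑ k ∈ K.erase k₀, f ⟨k, t k⟩) := by
    intro f
    rw [sum_eq_add_sum_of_eq_zero hi fun i h1 h2 => by rw [hy0 i h1 h2, mul_zero],
      Finset.sum_insert (Finset.notMem_erase _ _), hyi, hyk, hji, hjk]
    congr 2
    exact Finset.sum_congr rfl fun k hk => by rw [hyK k hk, hjK k hk, mul_one]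
  have := selPoint_mem_span_face (a := a) (g := g) (b := b) (δ := δ)
    (j := j) (y := y) (fun i => ?_) (by rwa [hsum]) (by rwa [hsum])
  · rw [sum_eq_add_sum_of_eq_zero hi fun i h1 h2 => by rw [hy0 i h1 h2, zero_smul],
      Finset.sum_insert (Finset.notMem_erase _ _), hyi, hyk, hji, hjk] at this
    convert this using 3
    exact Finset.sum_congr rfl fun k hk => by rw [hyK k hk, hjK k hk, one_smul]
  · simp only [hy]
    split_ifs
    · exact hs
    · exact hs₀
    · simp
    · simp

end CKP

/-- Theorem 4 in de Farias et al., facet case. If moreover every element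
of `C` other than `(i', j')` is of the form `(i, n i)` (0-based: `t i = n i - 1`), then
the lifted cover inequality (q2) is facet-defining for `PS`. -/
theorem ckp_lifted_cover_ineq2_facet {m : ℕ} (n : Fin m → ℕ) (hn : ∀ i, 0 < n i)
    (a : CKP.Idx n → ℝ) (b : ℝ)
    (ha : ∀ q : CKP.Idx n, 0 ≤ a q)
    (hmono : ∀ (i : Fin m) (j j' : Fin (n i)), (j : ℕ) ≤ (j' : ℕ) → a ⟨i, j'⟩ ≤ a ⟨i, j⟩)
    (hb : 0 < b)
    (hM : ∃ i, n i ≠ 1)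
    (hbig : b < ∑ i : Fin m, a ⟨i, ⟨0, hn i⟩⟩)
    (MC : Finset (Fin m)) (i' : Fin m) (hi' : i' ∈ MC)
    (j' : Fin (n i')) (hj' : (j' : ℕ) + 1 < n i')
    (t : ∀ i, Fin (n i))
    (ht : ∀ i ∈ MC.erase i', (t i : ℕ) = n i - 1)
    (hcover : b < (∑ i ∈ MC.erase i', a ⟨i, t i⟩) + a ⟨i', j'⟩)
    (hcond : (∑ i ∈ MC.erase i', a ⟨i, t i⟩)
        + a ⟨i', ⟨n i' - 1, Nat.sub_lt (hn i') Nat.one_pos⟩⟩ < b) :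
    CKP.IsFacetDefining n a b (fun x => q2LHS n hn a b MC i' t x) b := by
  set K := MC.erase i' with hKdef
  have hK : i' ∉ K := Finset.notMem_erase _ _
  set A := ∑ k ∈ K, a ⟨k, t k⟩ with hA
  set z : Fin (n i') := ⟨n i' - 1, Nat.sub_lt (hn i') Nat.one_pos⟩ with hz
  set c := a ⟨i', z⟩ with hc
  set r := b - A with hr
  have hc0 : 0 ≤ c := ha _
  have hcr : c < r := by linarith
  have hr0 : 0 < r := by linarith
  have hbr : b = r + A := by linarith
  have hcmin : ∀ l, c ≤ a ⟨i', l⟩ := fun l => hmono _ _ _ (by simp only [hz]; omega)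
  have hαmin : ∀ k ∈ K, ∀ l, a ⟨k, t k⟩ ≤ a ⟨k, l⟩ :=
    fun k hk l => hmono _ _ _ (by have := ht k hk; omega)
  have hα0 : ∀ k, 0 ≤ a ⟨k, t k⟩ := fun k => ha _
  set g : CKP.Idx n → ℝ := fun q =>
    if q.1 = i' then max (a q) r
    else if q.1 ∈ K then a ⟨q.1, t q.1⟩ * max 1 (a q / (r - c + a ⟨q.1, t q.1⟩))
    else 0 with hgdef
  have hgi : ∀ l, g ⟨i', l⟩ = max (a ⟨i', l⟩) r := fun l => by simp [hgdef]
  have hne : ∀ k ∈ K, k ≠ i' := fun k hk => Finset.ne_of_mem_erase hk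
  have hgK : ∀ k ∈ K, ∀ l,
      g ⟨k, l⟩ = a ⟨k, t k⟩ * max 1 (a ⟨k, l⟩ / (r - c + a ⟨k, t k⟩)) :=
    fun k hk l => by simp [hgdef, hne k hk, hk]
  have hg0 : ∀ k, k ≠ i' → k ∉ K → ∀ l, g ⟨k, l⟩ = 0 := fun k h1 h2 l => by
    simp [hgdef, h1, h2]
  have hD : ∀ k, 0 < r - c + a ⟨k, t k⟩ := fun k => by linarith [hα0 k]
  have hgt : ∀ k ∈ K, g ⟨k, t k⟩ = a ⟨k, t k⟩ := fun k hk => by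
    rw [hgK k hk, max_eq_left, mul_one]
    rw [div_le_one (hD k)]
    linarith
  have hgA : ∑ k ∈ K, g ⟨k, t k⟩ = A := Finset.sum_congr rfl hgt
  have hAe : ∀ k ∈ K, ∑ i ∈ K.erase k, a ⟨i, t i⟩ = A - a ⟨k, t k⟩ := fun k hk => by
    rw [hA, ← Finset.add_sum_erase K _ hk]
    ring
  have hgAe : ∀ k, ∑ i ∈ K.erase k, g ⟨i, t i⟩ = ∑ i ∈ K.erase k, a ⟨i, t i⟩ := fun k =>
    Finset.sum_congr rfl fun i hi => hgt i (Finset.mem_of_mem_erase hi)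
  have hq2 : (fun x => q2LHS n hn a b MC i' t x) = fun x => ∑ q, g q * x q := by
    funext x
    rw [Fintype.sum_sigma,
      CKP.sum_eq_add_sum_of_eq_zero hK fun i h1 h2 => by simp [hg0 i h1 h2]]
    unfold q2LHS
    congr 1
    · exact Finset.sum_congr rfl fun l _ => by rw [hgi]
    · refine Finset.sum_congr rfl fun k hk => Finset.sum_congr rfl fun l _ => ?_
      have hkl : (l : ℕ) ≤ (t k : ℕ) := by have := ht k hk; omega
      rw [if_pos hkl, hgK k hk, hAe k hk]
      congr 4
      linarith
  rw [hq2]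
  have hvalid : ∀ x ∈ CKP.PS n a b, ∑ q, g q * x q ≤ b := by
    refine fun x hx => CKP.sum_mul_le_of_mem_PS hn (fun j y hy hknap => ?_) hx
    have hsub : a ⟨i', j i'⟩ * y i' + ∑ k ∈ K, a ⟨k, j k⟩ * y k ≤ r + A := by
      rw [← hbr, ← Finset.sum_insert hK (f := fun k => a ⟨k, j k⟩ * y k)]
      exact (Finset.sum_le_sum_of_subset_of_nonneg (Finset.subset_univ _)
        fun i _ _ => mul_nonneg (ha _) (hy i).1).trans hknap
    rw [CKP.sum_eq_add_sum_of_eq_zero hK fun i h1 h2 => by rw [hg0 i h1 h2, zero_mul], hbr, hgi,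
      Finset.sum_congr rfl fun k hk => by rw [hgK k hk]]
    exact lifted_cover_valid K (fun k => a ⟨k, t k⟩) (fun k => a ⟨k, j k⟩) y hcr
      (fun k _ => hα0 k) (fun k hk => hαmin k hk _) (fun k _ => hy k) (hy i') hr0.le (hcmin _) hsub
  refine ⟨hvalid, ?_⟩
  set W := Submodule.span ℝ {x ∈ CKP.PS n a b | ∑ q, g q * x q = b} with hW
  let e : CKP.Idx n → CKP.Idx n → ℝ := fun q => Pi.single q 1
  set E := ∑ k ∈ K, e ⟨k, t k⟩ with hE
  have hEe : ∀ k ∈ K, ∑ i ∈ K.erase k, e ⟨i, t i⟩ = E - e ⟨k, t k⟩ := fun k hk => by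
    rw [hE, ← Finset.add_sum_erase K _ hk]
    abel
  have hbase : ∀ l s, s ∈ Set.Icc (0 : ℝ) 1 → a ⟨i', l⟩ * s ≤ r → max (a ⟨i', l⟩) r * s = r →
      s • e ⟨i', l⟩ + E ∈ W := fun l s hs h1 h2 =>
    CKP.single_add_sum_mem_span_face hK t l hs (by linarith) (by rw [hgi, h2, hgA, hbr])
  have hone : ∀ l s k (l₀ : Fin (n k)) s₀, k ≠ i' → s ∈ Set.Icc (0 : ℝ) 1 →
      s₀ ∈ Set.Icc (0 : ℝ) 1 →
      a ⟨i', l⟩ * s + (a ⟨k, l₀⟩ * s₀ + ∑ i ∈ K.erase k, a ⟨i, t i⟩) ≤ b →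
      max (a ⟨i', l⟩) r * s + (g ⟨k, l₀⟩ * s₀ + ∑ i ∈ K.erase k, a ⟨i, t i⟩) = b →
      s • e ⟨i', l⟩ + (s₀ • e ⟨k, l₀⟩ + ∑ i ∈ K.erase k, e ⟨i, t i⟩) ∈ W :=
    fun l s k l₀ s₀ hk hs hs₀ h1 h2 =>
      CKP.single_add_single_add_sum_mem_span_face hK t l hk l₀ hs hs₀ h1
        (by rw [hgi, hgAe, h2])
  have hlarge : ∀ l, r < a ⟨i', l⟩ → (r / a ⟨i', l⟩) • e ⟨i', l⟩ + E ∈ W := fun l hl => by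
    have hpos : 0 < a ⟨i', l⟩ := hr0.trans hl
    have hrl : a ⟨i', l⟩ * (r / a ⟨i', l⟩) = r := by field_simp
    exact hbase l _ ⟨(div_pos hr0 hpos).le, (div_le_one hpos).2 hl.le⟩ hrl.le
      (by rw [max_eq_left hl.le, hrl])
  have hsmall : ∀ l, a ⟨i', l⟩ ≤ r → e ⟨i', l⟩ + E ∈ W := fun l hl => by
    simpa using hbase l 1 (by simp) (by linarith) (by rw [max_eq_right hl, mul_one])
  have hlast := hsmall z hcr.le
  set v := a ⟨i', j'⟩ with hv
  have hrv : r < v := by linarith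
  have hv0 : 0 < v := hr0.trans hrv
  have hex : ∀ k ∈ K, e ⟨k, t k⟩ - (a ⟨k, t k⟩ / v) • e ⟨i', j'⟩ ∈ W := by
    intro k hk
    obtain ⟨ε, hε0, hε1, hεv⟩ : ∃ ε : ℝ, 0 < ε ∧ ε ≤ 1 ∧ r + ε * a ⟨k, t k⟩ ≤ v := by
      have hpos : 0 < a ⟨k, t k⟩ + 1 := by linarith [hα0 k]
      refine ⟨min 1 ((v - r) / (a ⟨k, t k⟩ + 1)), lt_min one_pos (div_pos (by linarith) hpos),
        min_le_left _ _, ?_⟩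
      have h1 := min_le_right 1 ((v - r) / (a ⟨k, t k⟩ + 1))
      have h0 : 0 < min 1 ((v - r) / (a ⟨k, t k⟩ + 1)) :=
        lt_min one_pos (div_pos (by linarith) hpos)
      rw [le_div_iff₀ hpos] at h1
      nlinarith
    have hmul : v * ((r + ε * a ⟨k, t k⟩) / v) = r + ε * a ⟨k, t k⟩ := by field_simp
    have hpt := hone j' ((r + ε * a ⟨k, t k⟩) / v) k (t k) (1 - ε) (hne k hk)
      ⟨div_nonneg (by nlinarith [hα0 k]) hv0.le, (div_le_one hv0).2 hεv⟩
      ⟨by linarith, by linarith⟩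
      (by rw [← hv, hmul, hAe k hk]; linarith)
      (by rw [← hv, max_eq_left hrv.le, hmul, hgt k hk, hAe k hk]; linarith)
    rw [hEe k hk] at hpt
    have hdiff := W.smul_mem ε⁻¹ (W.sub_mem (hlarge j' hrv) hpt)
    convert hdiff using 1
    rw [← hv]
    ext q
    simp only [Pi.sub_apply, Pi.smul_apply, Pi.add_apply, smul_eq_mul]
    field_simp
    ring
  have hej : e ⟨i', j'⟩ ∈ W := by
    have h1 := W.sub_mem (hlarge j' hrv) (W.sum_mem hex)
    rw [Finset.sum_sub_distrib, ← Finset.sum_smul, ← Finset.sum_div, ← hA, ← hE, ← hv] at h1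
    have h2 := W.smul_mem (v / b) h1
    convert h2 using 1
    ext q
    simp only [Pi.sub_apply, Pi.smul_apply, Pi.add_apply, smul_eq_mul]
    field_simp
    rw [hr]
    ring
  have het : ∀ k ∈ K, e ⟨k, t k⟩ ∈ W := fun k hk => by
    simpa using W.add_mem (hex k hk) (W.smul_mem (a ⟨k, t k⟩ / v) hej)
  have hEW : E ∈ W := W.sum_mem het
  have hei : ∀ l, e ⟨i', l⟩ ∈ W := by
    intro l
    rcases le_or_gt (a ⟨i', l⟩) r with hl | hl
    · exact (W.add_mem_iff_left hEW).1 (hsmall l hl)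
    · exact (W.smul_mem_iff (div_pos hr0 (hr0.trans hl)).ne').1
        ((W.add_mem_iff_left hEW).1 (hlarge l hl))
  have hall : ∀ q, e q ∈ W := by
    rintro ⟨k, l⟩
    by_cases hki : k = i'
    · subst hki
      exact hei l
    have hsumW : ∑ i ∈ K.erase k, e ⟨i, t i⟩ ∈ W :=
      W.sum_mem fun i hi => het i (Finset.mem_of_mem_erase hi)
    suffices h : ∃ s₀ : ℝ, 0 < s₀ ∧ s₀ ≤ 1 ∧
        c + (a ⟨k, l⟩ * s₀ + ∑ i ∈ K.erase k, a ⟨i, t i⟩) ≤ b ∧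
        r + (g ⟨k, l⟩ * s₀ + ∑ i ∈ K.erase k, a ⟨i, t i⟩) = b by
      obtain ⟨s₀, hs0, hs1, h1, h2⟩ := h
      have hpt := hone z 1 k l s₀ hki (by simp) ⟨hs0.le, hs1⟩ (by rwa [mul_one])
        (by rwa [mul_one, max_eq_right hcr.le])
      exact (W.smul_mem_iff hs0.ne').1 ((W.add_mem_iff_left hsumW).1
        ((W.add_mem_iff_right (W.smul_mem 1 (hei z))).1 hpt))
    by_cases hk : k ∈ K
    · rw [hAe k hk, hgK k hk]
      rcases le_or_gt (a ⟨k, l⟩) (r - c + a ⟨k, t k⟩) with hl | hl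
      · refine ⟨1, one_pos, le_rfl, by linarith, ?_⟩
        rw [max_eq_left ((div_le_one (hD k)).2 hl)]
        linarith
      · have hpos : 0 < a ⟨k, l⟩ := (hD k).trans hl
        refine ⟨(r - c + a ⟨k, t k⟩) / a ⟨k, l⟩, div_pos (hD k) hpos,
          (div_le_one hpos).2 hl.le, ?_, ?_⟩
        · rw [mul_div_cancel₀ _ hpos.ne']
          linarith
        · have := (hD k).ne'
          rw [max_eq_right ((one_le_div (hD k)).2 hl.le), mul_assoc,
            div_mul_div_cancel₀ this, div_self hpos.ne']
          linarith
    · rw [Finset.erase_eq_of_notMem hk, hg0 k hki hk, ← hA]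
      have hpos : 0 < a ⟨k, l⟩ + 1 := by linarith [ha ⟨k, l⟩]
      have h0 : 0 < min 1 ((r - c) / (a ⟨k, l⟩ + 1)) :=
        lt_min one_pos (div_pos (by linarith) hpos)
      refine ⟨_, h0, min_le_left _ _, ?_, by linarith⟩
      have h1 := min_le_right 1 ((r - c) / (a ⟨k, l⟩ + 1))
      rw [le_div_iff₀ hpos] at h1
      nlinarith
  have htop : W = ⊤ := by
    rw [eq_top_iff]
    intro x _
    rw [pi_eq_sum_univ' x]
    refine W.sum_mem fun q _ => W.smul_mem _ (hall q)
  have hFne : {x ∈ CKP.PS n a b | ∑ q, g q * x q = b}.Nonempty := by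
    rw [Set.nonempty_iff_ne_empty]
    intro hempty
    have h := hej
    rw [hW, hempty, Submodule.span_empty, Submodule.mem_bot] at h
    simpa [e] using congrFun h ⟨i', j'⟩
  exact finrank_direction_of_span_eq_top (∑ q, g q • LinearMap.proj q) hb.ne'
    (fun x hx => by simpa [LinearMap.sum_apply] using hx.2) hFne htop
end

section
/- (Forward direction of the NP-hardness reduction for problem SP1.) In the partition-reduction CKP instance, suppose S ⊆ {1,…,k} satisfies ∑_{i∈S} α_i = β. Set C := {(i,1) : i ∈ S ∪ {k+1}}. Then C is a cover (∑_{(i,j)∈C} a_{ij} = β + 3 > b), and the point x* violates the corresponding inequality of the form (q1): ∑_{i∈M_C} ∑_{j=1}^{r_i−1} a_{i r_i} x*_{ij} + ∑_{i∈M_C} ∑_{j=r_i}^{n_i} max{ a_{ij}, b − ∑_{k'∈M_C, k'≠i} a_{k' r_{k'}} } x*_{ij} = β + 5/2 > b, where r_i = 1 for all i ∈ M_C. -/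
open Finset

namespace PR

/-- The row sizes of the partition-reduction CKP instance:
`n_1 = … = n_k = 1`, `n_{k+1} = β + 1`. -/
def n (k β : ℕ) : Fin (k + 1) → ℕ := fun i => if i = Fin.last k then β + 1 else 1

theorem npos (k β : ℕ) : ∀ i, 0 < n k β i := by
  intro i
  unfold n
  split <;> omega

/-- The knapsack coefficients of the partition-reduction CKP instance:
`a_{i1} = α_i` for `i ≤ k`, `a_{k+1,1} = 3`, `a_{k+1,j} = 1` for `2 ≤ j ≤ β + 1`. -/
noncomputable def a (k β : ℕ) (α : Fin k → ℕ) : CKP.Idx (n k β) → ℝ :=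
  fun q => if h : q.1 = Fin.last k then (if (q.2 : ℕ) = 0 then 3 else 1)
           else (α (q.1.castPred h) : ℝ)

/-- The LP-optimal point `x*` of the partition-reduction CKP instance:
`x*_{i1} = (2β − 3)/(6β)` for `i ≤ k`, `x*_{k+1,1} = 1`, `x*_{k+1,j} = 1/3` for
`2 ≤ j ≤ β + 1`. -/
noncomputable def xstar (k β : ℕ) : CKP.Idx (n k β) → ℝ :=
  fun q => if q.1 = Fin.last k then (if (q.2 : ℕ) = 0 then 1 else 1 / 3)
           else (2 * (β : ℝ) - 3) / (6 * (β : ℝ))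

/-- The first element (`j = 1`, 0-based `0`) of each special ordered set. -/
def r0 (k β : ℕ) (i : Fin (k + 1)) : Fin (n k β i) := ⟨0, npos k β i⟩

end PR

namespace PR

theorem n_last (k β : ℕ) : n k β (Fin.last k) = β + 1 := by simp [n]

theorem n_castSucc (k β : ℕ) (i : Fin k) : n k β i.castSucc = 1 := by
  simp [n, Fin.castSucc_ne_last]

theorem a_last (k β : ℕ) (α : Fin k → ℕ) (j : Fin (n k β (Fin.last k))) :
    a k β α ⟨Fin.last k, j⟩ = if (j : ℕ) = 0 then 3 else 1 := by
  simp [a]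

theorem a_castSucc (k β : ℕ) (α : Fin k → ℕ) (i : Fin k) (j : Fin (n k β i.castSucc)) :
    a k β α ⟨i.castSucc, j⟩ = α i := by
  simp [a, Fin.castSucc_ne_last]

theorem xstar_last (k β : ℕ) (j : Fin (n k β (Fin.last k))) :
    xstar k β ⟨Fin.last k, j⟩ = if (j : ℕ) = 0 then 1 else 1 / 3 := by
  simp [xstar]

theorem xstar_castSucc (k β : ℕ) (i : Fin k) (j : Fin (n k β i.castSucc)) :
    xstar k β ⟨i.castSucc, j⟩ = (2 * (β : ℝ) - 3) / (6 * (β : ℝ)) := by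
  simp [xstar, Fin.castSucc_ne_last]

theorem sum_image_castSucc_union_last {k : ℕ} (T : Finset (Fin k)) (f : Fin (k + 1) → ℝ) :
    ∑ i ∈ T.image Fin.castSucc ∪ {Fin.last k}, f i =
      ∑ i ∈ T, f i.castSucc + f (Fin.last k) := by
  rw [Finset.sum_union (by simp [Fin.castSucc_ne_last]), Finset.sum_singleton,
    Finset.sum_image fun _ _ _ _ h => Fin.castSucc_injective k h]

/-- The cover induced by a partition certificate has weight `β + 3`. -/
theorem sum_a_cover (k β : ℕ) (α : Fin k → ℕ) (T : Finset (Fin k)) (hT : ∑ i ∈ T, α i = β) :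
    ∑ i ∈ T.image Fin.castSucc ∪ {Fin.last k}, a k β α ⟨i, r0 k β i⟩ = (β : ℝ) + 3 := by
  rw [sum_image_castSucc_union_last]
  simp only [a_castSucc, a_last, r0, if_true]
  rw [← Nat.cast_sum, hT]

/-- The residual capacity left for an element of the cover by its other elements. -/
theorem residual_eq (k β : ℕ) (α : Fin k → ℕ) (T : Finset (Fin k)) (hT : ∑ i ∈ T, α i = β)
    {i : Fin (k + 1)} (hi : i ∈ T.image Fin.castSucc ∪ {Fin.last k}) :
    (β : ℝ) + 2 - ∑ l ∈ (T.image Fin.castSucc ∪ {Fin.last k}).erase i, a k β α ⟨l, r0 k β l⟩ =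
      a k β α ⟨i, r0 k β i⟩ - 1 := by
  have h := Finset.add_sum_erase _ (fun l => a k β α ⟨l, r0 k β l⟩) hi
  rw [sum_a_cover k β α T hT] at h
  linarith

end PR

open Fin in
/-- forward direction of the NP-hardness reduction for SP1.
If `T ⊆ {1,…,k}` is a yes-certificate of the partition problem, then
`C = {(i,1) : i ∈ T ∪ {k+1}}` is a cover (`∑_{(i,j)∈C} a_{ij} = β + 3 > b = β + 2`) and
`x*` violates the corresponding inequality (q1), whose left-hand side evaluates to
`β + 5/2 > b`. -/
theorem ckp_SP1_reduction_forward (k β : ℕ) (α : Fin k → ℕ)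
    (hα : ∀ i, 0 < α i) (hβ : 2 ≤ β) (hsumα : ∑ i, α i = 2 * β)
    (T : Finset (Fin k)) (hT : ∑ i ∈ T, α i = β) :
    ((∑ i ∈ T.image Fin.castSucc ∪ {Fin.last k}, PR.a k β α ⟨i, PR.r0 k β i⟩)
        = (β : ℝ) + 3
      ∧ (β : ℝ) + 2 < (β : ℝ) + 3)
    ∧ (q1LHS (PR.n k β) (PR.a k β α) ((β : ℝ) + 2)
          (T.image Fin.castSucc ∪ {Fin.last k}) (PR.r0 k β) (PR.xstar k β)
        = (β : ℝ) + 5 / 2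
      ∧ (β : ℝ) + 2 < (β : ℝ) + 5 / 2) := by
  refine ⟨⟨PR.sum_a_cover k β α T hT, by linarith⟩, ?_, by linarith⟩
  have hβ0 : (β : ℝ) ≠ 0 := by positivity
  have row_castSucc (i : Fin k) :
      ∑ j : Fin (PR.n k β i.castSucc), max (PR.a k β α ⟨i.castSucc, j⟩)
          (PR.a k β α ⟨i.castSucc, PR.r0 k β i.castSucc⟩ - 1) * PR.xstar k β ⟨i.castSucc, j⟩ =
        α i * ((2 * (β : ℝ) - 3) / (6 * (β : ℝ))) := by
    simp [PR.a_castSucc, PR.xstar_castSucc, PR.n_castSucc]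
  have row_last :
      ∑ j : Fin (PR.n k β (Fin.last k)), max (PR.a k β α ⟨Fin.last k, j⟩)
          (PR.a k β α ⟨Fin.last k, PR.r0 k β (Fin.last k)⟩ - 1) *
            PR.xstar k β ⟨Fin.last k, j⟩ =
        3 + 2 / 3 * (β : ℝ) := by
    simp only [PR.a_last, PR.xstar_last, PR.r0, if_true]
    rw [Fin.sum_univ_eq_sum_range (fun j => max (if j = 0 then (3 : ℝ) else 1) (3 - 1) *
      if j = 0 then (1 : ℝ) else 1 / 3), PR.n_last, Finset.sum_range_succ']
    norm_num
    ring
  have residual : q1LHS (PR.n k β) (PR.a k β α) ((β : ℝ) + 2)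
      (T.image Fin.castSucc ∪ {Fin.last k}) (PR.r0 k β) (PR.xstar k β) =
      ∑ i ∈ T.image Fin.castSucc ∪ {Fin.last k}, ∑ j : Fin (PR.n k β i),
        max (PR.a k β α ⟨i, j⟩) (PR.a k β α ⟨i, PR.r0 k β i⟩ - 1) * PR.xstar k β ⟨i, j⟩ := by
    refine Finset.sum_congr rfl fun i hi => Finset.sum_congr rfl fun j _ => ?_
    rw [if_neg (show ¬(j : ℕ) < (PR.r0 k β i : ℕ) from Nat.not_lt_zero _),
      PR.residual_eq k β α T hT hi]
  rw [residual, PR.sum_image_castSucc_union_last, row_last,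
    Finset.sum_congr rfl fun i _ => row_castSucc i, ← Finset.sum_mul, ← Nat.cast_sum, hT]
  field_simp
  ring
end

section
/- (Backward direction of the NP-hardness reduction for problem SP1.) In the partition-reduction CKP instance, let C = {(i, r_i) : i ∈ M_C} ⊆ I be a cover for which there exist i' ∈ M_C and j' ∈ N_{i'} with r_{i'} < j' ≤ n_{i'} satisfying ∑_{i∈M_C, i≠i'} a_{i r_i} + a_{i'j'} < b, and suppose x* violates the inequality ∑_{i∈M_C} ∑_{j=1}^{r_i−1} a_{i r_i} x*_{ij} + ∑_{i∈M_C} ∑_{j=r_i}^{n_i} max{ a_{ij}, b − ∑_{k'∈M_C, k'≠i} a_{k' r_{k'}} } x*_{ij} > b. Then i' = k+1, (k+1,1) ∈ C, and ∑_{i∈M_C∩{1,…,k}} α_i = β, i.e., M_C ∩ {1,…,k} is a yes-certificate for the partition problem. -/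
open Finset

namespace PR

theorem n_of_ne_last {k β : ℕ} {i : Fin (k + 1)} (h : i ≠ Fin.last k) : n k β i = 1 := by
  simp [n, h]

theorem sum_erase_last (k β : ℕ) (α : Fin k → ℕ) (MC : Finset (Fin (k + 1)))
    (r : ∀ i, Fin (n k β i)) :
    ∑ i ∈ MC.erase (Fin.last k), a k β α ⟨i, r i⟩ =
      ((∑ i ∈ Finset.univ.filter (fun i : Fin k => i.castSucc ∈ MC), α i : ℕ) : ℝ) := by
  have himage : MC.erase (Fin.last k) =
      (Finset.univ.filter (fun i : Fin k => i.castSucc ∈ MC)).map Fin.castSuccEmb := by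
    ext i
    induction i using Fin.lastCases with
    | last => simp [Fin.castSucc_ne_last]
    | cast i => simp [Fin.castSucc_ne_last]
  rw [himage, Finset.sum_map, Nat.cast_sum]
  exact Finset.sum_congr rfl fun i _ => a_castSucc k β α i _

end PR

/-- backward direction of the NP-hardness reduction for SP1.
If `C = {(i, r i) : i ∈ MC}` is a cover of the partition-reduction instance admitting the
lifting condition of Theorem 3, and `x*` violates the corresponding inequality (q1), then
`i' = k + 1`, `(k+1, 1) ∈ C`, and `M_C ∩ {1,…,k}` is a yes-certificate for the partition
problem. -/
theorem ckp_SP1_reduction_backward (k β : ℕ) (α : Fin k → ℕ)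
    (hα : ∀ i, 0 < α i) (hβ : 2 ≤ β) (hsumα : ∑ i, α i = 2 * β)
    (MC : Finset (Fin (k + 1))) (r : ∀ i, Fin (PR.n k β i))
    (hcover : (β : ℝ) + 2 < ∑ i ∈ MC, PR.a k β α ⟨i, r i⟩)
    (i' : Fin (k + 1)) (hi' : i' ∈ MC) (j' : Fin (PR.n k β i'))
    (hrj : (r i' : ℕ) < (j' : ℕ))
    (hlift : (∑ i ∈ MC.erase i', PR.a k β α ⟨i, r i⟩) + PR.a k β α ⟨i', j'⟩ < (β : ℝ) + 2)
    (hviol : (β : ℝ) + 2 <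
        q1LHS (PR.n k β) (PR.a k β α) ((β : ℝ) + 2) MC r (PR.xstar k β)) :
    i' = Fin.last k ∧ Fin.last k ∈ MC ∧ (r (Fin.last k) : ℕ) = 0 ∧
      (∑ i ∈ Finset.univ.filter (fun i : Fin k => i.castSucc ∈ MC), α i) = β := by
  have hlast : i' = Fin.last k := by
    by_contra h
    have hj := j'.isLt
    have hn := PR.n_of_ne_last (β := β) h
    omega
  subst hlast
  have hj' : (j' : ℕ) ≠ 0 := by omega
  rw [PR.sum_erase_last, PR.a_last, if_neg hj'] at hlift
  rw [← Finset.add_sum_erase _ _ hi', PR.sum_erase_last, PR.a_last] at hcover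
  have hr : (r (Fin.last k) : ℕ) = 0 := by
    by_contra h
    rw [if_neg h] at hcover
    linarith
  rw [if_pos hr] at hcover
  refine ⟨rfl, hi', hr, le_antisymm ?_ ?_⟩
  · refine Nat.lt_succ_iff.mp ?_
    rify
    push_cast at hlift
    linarith
  · refine Nat.lt_succ_iff.mp ?_
    rify
    push_cast at hcover
    linarith
end

section
/- (Forward direction of the NP-hardness reduction for problem SP2.) In the partition-reduction CKP instance, suppose S ⊆ {1,…,k} satisfies ∑_{i∈S} α_i = β. Set C := {(i,1) : i ∈ S ∪ {k+1}} and (i',j') := (k+1,1). Then C is a cover, ∑_{i∈M_C, i≠i'} a_{i t_i} + a_{i' n_{i'}} = β + 1 < b (where t_i = 1 for i ∈ M_C, i ≠ i'), and x* violates the corresponding inequality of the form (q2): ∑_{j∈N_{i'}} max{ a_{i'j}, b − ∑_{k'∈M_C, k'≠i'} a_{k' t_{k'}} } x*_{i'j} + ∑_{i∈M_C, i≠i'} ( ∑_{j=1}^{t_i} a_{i t_i} · max{ 1, a_{ij} / (b − ∑_{k'∈M_C, k'∉{i,i'}} a_{k' t_{k'}} − a_{i' n_{i'}}) } x*_{ij}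 + ∑_{j=t_i+1}^{n_i} a_{ij} x*_{ij} ) = β + 5/2 > b. -/
open Finset

namespace PR

theorem sum_row_last (k β : ℕ) (f : ℕ → ℝ) :
    ∑ j : Fin (n k β (Fin.last k)), f j = (∑ j ∈ range β, f (j + 1)) + f 0 := by
  rw [Fin.sum_univ_eq_sum_range, n_last, sum_range_succ']

theorem sum_row_castSucc (k β : ℕ) (i : Fin k) (c : ℝ) :
    ∑ _j : Fin (n k β i.castSucc), c = c := by
  simp [n_castSucc]

theorem erase_last_image_castSucc {k : ℕ} (T : Finset (Fin k)) :
    (T.image Fin.castSucc ∪ {Fin.last k}).erase (Fin.last k) = T.map Fin.castSuccEmb := by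
  ext x
  induction x using Fin.lastCases <;> simp [(Fin.castSucc_lt_last _).ne]

end PR

/-- forward direction of the NP-hardness reduction for SP2.
If `T ⊆ {1,…,k}` is a yes-certificate of the partition problem, then with
`C = {(i,1) : i ∈ T ∪ {k+1}}` and `(i', j') = (k+1, 1)`: `C` is a cover,
`∑_{i ∈ M_C, i ≠ i'} a_{i t_i} + a_{i' n_{i'}} = β + 1 < b = β + 2`, and `x*` violates
the corresponding inequality (q2), whose left-hand side evaluates to `β + 5/2 > b`. -/
theorem ckp_SP2_reduction_forward (k β : ℕ) (α : Fin k → ℕ)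
    (hα : ∀ i, 0 < α i) (hβ : 2 ≤ β) (hsumα : ∑ i, α i = 2 * β)
    (T : Finset (Fin k)) (hT : ∑ i ∈ T, α i = β) :
    ((β : ℝ) + 2 < ∑ i ∈ T.image Fin.castSucc ∪ {Fin.last k}, PR.a k β α ⟨i, PR.r0 k β i⟩)
    ∧ ((∑ i ∈ (T.image Fin.castSucc ∪ {Fin.last k}).erase (Fin.last k),
            PR.a k β α ⟨i, PR.r0 k β i⟩)
          + PR.a k β α ⟨Fin.last k, ⟨PR.n k β (Fin.last k) - 1,
              Nat.sub_lt (PR.npos k β (Fin.last k)) Nat.one_pos⟩⟩ = (β : ℝ) + 1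
        ∧ (β : ℝ) + 1 < (β : ℝ) + 2)
    ∧ (q2LHS (PR.n k β) (PR.npos k β) (PR.a k β α) ((β : ℝ) + 2)
          (T.image Fin.castSucc ∪ {Fin.last k}) (Fin.last k) (PR.r0 k β) (PR.xstar k β)
        = (β : ℝ) + 5 / 2
      ∧ (β : ℝ) + 2 < (β : ℝ) + 5 / 2) := by
  have hβ0 : (β : ℝ) ≠ 0 := by positivity
  have hTα : ∑ i ∈ T, (α i : ℝ) = β := by exact_mod_cast hT
  have hsum : ∑ i ∈ T.map Fin.castSuccEmb, PR.a k β α ⟨i, PR.r0 k β i⟩ = β := by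
    simp [PR.a_castSucc, hTα]
  have hlast : PR.a k β α ⟨Fin.last k, ⟨PR.n k β (Fin.last k) - 1,
      Nat.sub_lt (PR.npos k β (Fin.last k)) Nat.one_pos⟩⟩ = 1 := by
    rw [PR.a_last, if_neg]
    simp only [PR.n_last]
    omega
  refine ⟨?_, ⟨?_, by linarith⟩, ?_, by linarith⟩
  · rw [← sum_erase_add _ _ (mem_union_right _ (mem_singleton_self (Fin.last k))),
      PR.erase_last_image_castSucc, hsum, PR.a_last]
    simp only [PR.r0, if_true]
    linarith
  · rw [PR.erase_last_image_castSucc, hsum, hlast]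
  · have hrow : ∀ i ∈ T, (∑ j : Fin (PR.n k β i.castSucc),
        (if (j : ℕ) ≤ (PR.r0 k β i.castSucc : ℕ)
         then PR.a k β α ⟨i.castSucc, PR.r0 k β i.castSucc⟩ *
            max 1 (PR.a k β α ⟨i.castSucc, j⟩ / ((β : ℝ) + 2
              - (∑ l ∈ (T.map Fin.castSuccEmb).erase i.castSucc, PR.a k β α ⟨l, PR.r0 k β l⟩)
              - 1))
         else PR.a k β α ⟨i.castSucc, j⟩) * PR.xstar k β ⟨i.castSucc, j⟩)
        = α i * ((2 * (β : ℝ) - 3) / (6 * (β : ℝ))) := by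
      intro i hi
      have herase : ∑ l ∈ (T.map Fin.castSuccEmb).erase i.castSucc,
          PR.a k β α ⟨l, PR.r0 k β l⟩ = β - α i := by
        have h := sum_erase_add (T.map Fin.castSuccEmb)
          (fun l => PR.a k β α ⟨l, PR.r0 k β l⟩) (mem_map_of_mem Fin.castSuccEmb hi)
        simp only [Fin.coe_castSuccEmb, PR.a_castSucc] at h
        linarith
      have hmax : max 1 ((α i : ℝ) / ((β : ℝ) + 2 - (β - α i) - 1)) = 1 := by
        have hpos : (0 : ℝ) ≤ α i := Nat.cast_nonneg _
        exact max_eq_left (div_le_one_of_le₀ (by linarith) (by linarith))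
      simp only [PR.a_castSucc, PR.xstar_castSucc, herase, hmax, mul_one, ite_self]
      exact PR.sum_row_castSucc k β i _
    rw [q2LHS, PR.erase_last_image_castSucc, hsum, hlast, sum_map]
    refine (congrArg (_ + ·) (sum_congr rfl hrow)).trans ?_
    rw [← sum_mul, hTα]
    simp only [PR.a_last, PR.xstar_last]
    rw [PR.sum_row_last k β (fun j => max (if j = 0 then (3 : ℝ) else 1) ((β : ℝ) + 2 - β) *
      (if j = 0 then 1 else 1 / 3))]
    have hthree : max (3 : ℝ) 2 = 3 := by norm_num
    have htwo : max (1 : ℝ) 2 = 2 := by norm_num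
    simp only [Nat.add_eq_zero_iff, one_ne_zero, and_false, if_false, if_true,
      add_sub_cancel_left, hthree, htwo, sum_const, card_range, nsmul_eq_mul]
    field_simp
    ring
end

section
/- (Backward direction of the NP-hardness reduction for problem SP2.) In the partition-reduction CKP instance, let C ⊆ I be a cover and (i',j') ∈ C with j' < n_{i'}; denote the elements of C other than (i',j') by (i, t_i) for i ∈ M_C, i ≠ i'. Suppose ∑_{i∈M_C, i≠i'} a_{i t_i} + a_{i' n_{i'}} < b, and suppose x* violates the corresponding inequality of the form (q2). Then (i',j') = (k+1,1) and ∑_{i∈M_C∩{1,…,k}} α_i = β, i.e., M_C ∩ {1,…,k} is a yes-certificate for the partition problem. -/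
open Finset

/-- The sum of the coefficients chosen by `t` over the rows of `MC` other than the last one
is the sum of the corresponding `α`, as each of these rows has a single element. -/
theorem PR.sum_a_erase_last (k β : ℕ) (α : Fin k → ℕ) (MC : Finset (Fin (k + 1)))
    (t : ∀ i, Fin (PR.n k β i)) :
    ∑ i ∈ MC.erase (Fin.last k), PR.a k β α ⟨i, t i⟩ =
      ((∑ i with i.castSucc ∈ MC, α i : ℕ) : ℝ) := by
  have hmap : MC.erase (Fin.last k) =
      (Finset.univ.filter fun i : Fin k => i.castSucc ∈ MC).map Fin.castSuccEmb := by
    ext i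
    induction i using Fin.lastCases <;> simp [Fin.castSucc_ne_last]
  rw [hmap, Finset.sum_map, Nat.cast_sum]
  refine Finset.sum_congr rfl fun i _ => ?_
  simp [PR.a, Fin.castSucc_ne_last]

/-- backward direction of the NP-hardness reduction for SP2.
If `C = {(i, t i) : i ∈ MC, i ≠ i'} ∪ {(i', j')}` is a cover of the partition-reduction
instance with `j' < n_{i'}` and `∑_{i ∈ M_C, i ≠ i'} a_{i t_i} + a_{i' n_{i'}} < b`, and
`x*` violates the corresponding inequality (q2), then `(i', j') = (k+1, 1)` and
`M_C ∩ {1,…,k}` is a yes-certificate for the partition problem. -/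
theorem ckp_SP2_reduction_backward (k β : ℕ) (α : Fin k → ℕ)
    (hα : ∀ i, 0 < α i) (hβ : 2 ≤ β) (hsumα : ∑ i, α i = 2 * β)
    (MC : Finset (Fin (k + 1))) (i' : Fin (k + 1)) (hi' : i' ∈ MC)
    (j' : Fin (PR.n k β i')) (hj' : (j' : ℕ) + 1 < PR.n k β i')
    (t : ∀ i, Fin (PR.n k β i))
    (hcover : (β : ℝ) + 2 <
        (∑ i ∈ MC.erase i', PR.a k β α ⟨i, t i⟩) + PR.a k β α ⟨i', j'⟩)
    (hcond : (∑ i ∈ MC.erase i', PR.a k β α ⟨i, t i⟩)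
        + PR.a k β α ⟨i', ⟨PR.n k β i' - 1,
            Nat.sub_lt (PR.npos k β i') Nat.one_pos⟩⟩ < (β : ℝ) + 2)
    (hviol : (β : ℝ) + 2 <
        q2LHS (PR.n k β) (PR.npos k β) (PR.a k β α) ((β : ℝ) + 2) MC i' t
          (PR.xstar k β)) :
    i' = Fin.last k ∧ (j' : ℕ) = 0 ∧
      (∑ i ∈ Finset.univ.filter (fun i : Fin k => i.castSucc ∈ MC), α i) = β := by
  have hlast : i' = Fin.last k := by
    by_contra h
    simp only [PR.n, if_neg h] at hj'
    omega
  subst hlast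
  rw [PR.sum_a_erase_last] at hcover hcond
  have hne : PR.n k β (Fin.last k) - 1 ≠ 0 := by
    simp only [PR.n, if_true]
    omega
  simp only [PR.a, dif_pos, if_neg hne] at hcover hcond
  have hle : ∑ i with i.castSucc ∈ MC, α i + 1 < β + 2 := by exact_mod_cast hcond
  split_ifs at hcover with h0
  · have hge : β + 2 < ∑ i with i.castSucc ∈ MC, α i + 3 := by exact_mod_cast hcover
    exact ⟨rfl, h0, by omega⟩
  · linarith
end

section
/- (First family of complementarity pack inequalities: validity.) Let P ⊆ I be a pack and s := ∑_{(i,j)∈P} a_{ij}. Then every x ∈ S (hence every x ∈ PS) satisfies ∑_{i∈M_P} ∑_{j∈N_i} a_{ij} x_{ij} + ∑_{(i,j)∈P, i∈M_P∖M_0} (b−s) x_{ij} ≤ b + (|M_P∖M_0| − 1)(b−s). -/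
open Finset

namespace CKP

variable {m : ℕ} {n : Fin m → ℕ} {a : Idx n → ℝ} {b : ℝ} {x : Idx n → ℝ}

lemma sum_mul_le_of_mem_S (ha : ∀ q, 0 ≤ a q) (hx : x ∈ S n a b) (MP : Finset (Fin m)) :
    ∑ i ∈ MP, ∑ j : Fin (n i), a ⟨i, j⟩ * x ⟨i, j⟩ ≤ b := by
  have hsum := hx.2.1
  rw [Fintype.sum_sigma] at hsum
  refine le_trans (Finset.sum_le_sum_of_subset_of_nonneg (Finset.subset_univ MP) ?_) hsum
  exact fun i _ _ => Finset.sum_nonneg fun j _ => mul_nonneg (ha _) (hx.1 _).1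

/-- If `x ⟨i, j⟩ ≠ 0`, or `j` is the only index in its block, the block of `i` contributes at most
`a ⟨i, j⟩` to the knapsack. -/
lemma block_sum_le_of_mem_S (ha : ∀ q, 0 ≤ a q) (hx : x ∈ S n a b) (i : Fin m) (j : Fin (n i))
    (h : n i ≠ 1 → x ⟨i, j⟩ ≠ 0) :
    ∑ k : Fin (n i), a ⟨i, k⟩ * x ⟨i, k⟩ ≤ a ⟨i, j⟩ := by
  rw [Finset.sum_eq_single j]
  · exact mul_le_of_le_one_right (ha _) (hx.1 _).2
  · intro k _ hk
    have hn : n i ≠ 1 := fun h1 => hk (Fin.ext (by omega))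
    rw [(mul_eq_zero.mp (hx.2.2 i k j hk)).resolve_right (h hn), mul_zero]
  · simp

/-- The first complementarity pack inequality holds on `S`. -/
lemma pack_ineq_of_mem_S (ha : ∀ q, 0 ≤ a q) (MP : Finset (Fin m)) (p : ∀ i, Fin (n i))
    (s : ℝ) (hs : s = ∑ i ∈ MP, a ⟨i, p i⟩) (hpack : s < b) (hx : x ∈ S n a b) :
    (∑ i ∈ MP, ∑ j : Fin (n i), a ⟨i, j⟩ * x ⟨i, j⟩)
      + (∑ i ∈ MP.filter (fun i => n i ≠ 1), (b - s) * x ⟨i, p i⟩)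
    ≤ b + (((MP.filter (fun i => n i ≠ 1)).card : ℝ) - 1) * (b - s) := by
  have hbs : 0 ≤ b - s := by linarith
  have hle (T : Finset (Fin m)) : ∑ i ∈ T, (b - s) * x ⟨i, p i⟩ ≤ T.card * (b - s) := by
    rw [← nsmul_eq_mul]
    exact Finset.sum_le_card_nsmul _ _ _ fun i _ => mul_le_of_le_one_right hbs (hx.1 _).2
  by_cases hz : ∃ i ∈ MP.filter (fun i => n i ≠ 1), x ⟨i, p i⟩ = 0
  · obtain ⟨i, hi, hxi⟩ := hz
    have h := hle ((MP.filter (fun i => n i ≠ 1)).erase i)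
    rw [Finset.cast_card_erase_of_mem hi] at h
    rw [← Finset.add_sum_erase _ _ hi, hxi]
    linarith [sum_mul_le_of_mem_S ha hx MP]
  · push Not at hz
    have h : ∑ i ∈ MP, ∑ j : Fin (n i), a ⟨i, j⟩ * x ⟨i, j⟩ ≤ s := by
      rw [hs]
      exact Finset.sum_le_sum fun i hi => block_sum_le_of_mem_S ha hx i (p i)
        fun h1 => hz i (Finset.mem_filter.mpr ⟨hi, h1⟩)
    linarith [hle (MP.filter (fun i => n i ≠ 1))]

end CKP

/-- first family of complementarity pack inequalities: validity.
Let `P = {(i, p i) : i ∈ MP}` be a pack and `s = ∑_{(i,j) ∈ P} a_{ij}`. Then the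
inequality (ieq 2) is valid for every point of `PS` (in particular for every point of
`S ⊆ PS`). Here `M_P ∖ M_0 = {i ∈ MP : n i ≠ 1}`. -/
theorem ckp_pack_ineq1_valid {m : ℕ} (n : Fin m → ℕ) (hn : ∀ i, 0 < n i)
    (a : CKP.Idx n → ℝ) (b : ℝ)
    (ha : ∀ q : CKP.Idx n, 0 ≤ a q)
    (hmono : ∀ (i : Fin m) (j j' : Fin (n i)), (j : ℕ) ≤ (j' : ℕ) → a ⟨i, j'⟩ ≤ a ⟨i, j⟩)
    (hb : 0 < b)
    (hM : ∃ i, n i ≠ 1)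
    (hbig : b < ∑ i : Fin m, a ⟨i, ⟨0, hn i⟩⟩)
    (MP : Finset (Fin m)) (p : ∀ i, Fin (n i))
    (s : ℝ) (hs : s = ∑ i ∈ MP, a ⟨i, p i⟩)
    (hpack : s < b)
    (x : CKP.Idx n → ℝ) (hx : x ∈ CKP.PS n a b) :
    (∑ i ∈ MP, ∑ j : Fin (n i), a ⟨i, j⟩ * x ⟨i, j⟩)
      + (∑ i ∈ MP.filter (fun i => n i ≠ 1), (b - s) * x ⟨i, p i⟩)
    ≤ b + (((MP.filter (fun i => n i ≠ 1)).card : ℝ) - 1) * (b - s) := by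
  refine convexHull_min (t := {y : CKP.Idx n → ℝ |
      (∑ i ∈ MP, ∑ j : Fin (n i), a ⟨i, j⟩ * y ⟨i, j⟩)
      + (∑ i ∈ MP.filter (fun i => n i ≠ 1), (b - s) * y ⟨i, p i⟩)
      ≤ b + (((MP.filter (fun i => n i ≠ 1)).card : ℝ) - 1) * (b - s)})
    (fun y hy => CKP.pack_ineq_of_mem_S ha MP p s hs hpack hy) ?_ hx
  refine convex_halfSpace_le ⟨fun y z => ?_, fun c y => ?_⟩ _
  · simp only [Pi.add_apply, mul_add, Finset.sum_add_distrib]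
    ring
  · simp only [Pi.smul_apply, smul_eq_mul, mul_add, Finset.mul_sum, mul_left_comm c]
end

section
/- (Second family of complementarity pack inequalities: validity.) Let P ⊆ I be a pack with |M_P∖M_0| ≥ 2 and s := ∑_{(i,j)∈P} a_{ij}. Let (i*, j*) ∈ P with i* ∉ M_0 and j* = n_{i*}. Then every x ∈ S (hence every x ∈ PS) satisfies ∑_{i∈M_P, i≠i*} ∑_{j∈N_i} a_{ij} x_{ij} + ∑_{(i,j)∈P, i∈M_P∖M_0, i≠i*} (b−s) x_{ij} + a_{i*j*} x_{i*j*} + ∑_{j∈N_{i*}, j≠j*} a_{i*j*} · max{ 1, a_{i*j} / (a_{i*j*} + b − s) } x_{i*j} ≤ b + (|M_P∖M_0| − 2)(b−s). -/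
open Finset

/-- If an entry of a family with at most one nonzero entry is nonzero, that entry carries all
weighted sums. -/
theorem sum_mul_eq_of_ne_zero {ι : Type*} [Fintype ι] (y g : ι → ℝ)
    (hy : ∀ j j', j ≠ j' → y j * y j' = 0) {j : ι} (hj : y j ≠ 0) :
    ∑ k, g k * y k = g j * y j := by
  refine Finset.sum_eq_single j (fun k _ hk => ?_) (by simp)
  have := (mul_eq_zero.1 (hy j k hk.symm)).resolve_left hj
  simp [this]

/-- A family with at most one nonzero entry has an index carrying all its weighted sums. -/
theorem exists_forall_sum_mul_eq {ι : Type*} [Fintype ι] [Nonempty ι] (y : ι → ℝ)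
    (hy : ∀ j j', j ≠ j' → y j * y j' = 0) :
    ∃ j, ∀ g : ι → ℝ, ∑ k, g k * y k = g j * y j := by
  by_cases h : ∃ j, y j ≠ 0
  · obtain ⟨j, hj⟩ := h
    exact ⟨j, fun g => sum_mul_eq_of_ne_zero y g hy hj⟩
  · push Not at h
    exact ⟨Classical.arbitrary ι, fun g => by simp [h]⟩

/-- The lifted coefficient is dominated by the original one. -/
theorem lifted_coeff_le {c w d : ℝ} (hc : 0 ≤ c) (hd : 0 < d) (hcw : c ≤ w) :
    c * max 1 (w / (c + d)) ≤ w := by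
  rcases max_cases 1 (w / (c + d)) with ⟨h, -⟩ | ⟨h, -⟩ <;> rw [h]
  · linarith
  · rw [mul_div_assoc', div_le_iff₀ (by linarith)]
    nlinarith

/-- The key estimate: `A` is the load outside one group, and `w * t` the load of that group. -/
theorem add_lifted_coeff_mul_le {A b c d w t : ℝ} (hc : 0 ≤ c) (hd : 0 < d)
    (ht1 : t ≤ 1) (hA : A + c ≤ b - d) (hAw : A + w * t ≤ b) :
    A + c * max 1 (w / (c + d)) * t ≤ b - d := by
  rcases max_cases 1 (w / (c + d)) with ⟨h, -⟩ | ⟨h, -⟩ <;> rw [h]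
  · nlinarith
  · have hcd : 0 < c + d := by linarith
    have e : c * (w / (c + d)) * t = c * (w * t / (c + d)) := by ring
    rw [e]
    rcases le_total (w * t / (c + d)) 1 with h1 | h1
    · nlinarith
    · have e2 : w * t = w * t / (c + d) * (c + d) := by field_simp
      nlinarith

/-- The inequality holds at every feasible point. -/
theorem ckp_pack_ineq2_valid_of_mem_S {m : ℕ} (n : Fin m → ℕ) (a : CKP.Idx n → ℝ) (b : ℝ)
    (ha : ∀ q : CKP.Idx n, 0 ≤ a q)
    (hmono : ∀ (i : Fin m) (j j' : Fin (n i)), (j : ℕ) ≤ (j' : ℕ) → a ⟨i, j'⟩ ≤ a ⟨i, j⟩)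
    (MP : Finset (Fin m)) (p : ∀ i, Fin (n i))
    (s : ℝ) (hs : s = ∑ i ∈ MP, a ⟨i, p i⟩) (hpack : s < b)
    (i₀ : Fin m) (hi₀ : i₀ ∈ MP) (hn₀ : n i₀ ≠ 1) (hp₀ : (p i₀ : ℕ) = n i₀ - 1)
    (x : CKP.Idx n → ℝ) (hx : x ∈ CKP.S n a b) :
    (∑ i ∈ MP.erase i₀, ∑ j : Fin (n i), a ⟨i, j⟩ * x ⟨i, j⟩)
      + (∑ i ∈ (MP.filter (fun i => n i ≠ 1)).erase i₀, (b - s) * x ⟨i, p i⟩)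
      + a ⟨i₀, p i₀⟩ * x ⟨i₀, p i₀⟩
      + (∑ j ∈ Finset.univ.erase (p i₀),
          a ⟨i₀, p i₀⟩ * max 1 (a ⟨i₀, j⟩ / (a ⟨i₀, p i₀⟩ + b - s)) * x ⟨i₀, j⟩)
    ≤ b + (((MP.filter (fun i => n i ≠ 1)).card : ℝ) - 2) * (b - s) := by
  obtain ⟨h01, hk, hc⟩ := hx
  have hd : 0 < b - s := by linarith
  set c := a ⟨i₀, p i₀⟩ with hcdef
  have hc0 : 0 ≤ c := ha _
  have hcle : ∀ j, c ≤ a ⟨i₀, j⟩ := fun j => hmono i₀ j (p i₀) (by have := j.2; omega)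
  set Q := (MP.filter (fun i => n i ≠ 1)).erase i₀ with hQ
  have hQc : ((MP.filter (fun i => n i ≠ 1)).card : ℝ) = Q.card + 1 := by
    rw [hQ, ← Finset.card_erase_add_one (a := i₀) (by simp [hi₀, hn₀])]
    push_cast; ring
  rw [hQc]
  set A := ∑ i ∈ MP.erase i₀, ∑ j : Fin (n i), a ⟨i, j⟩ * x ⟨i, j⟩ with hA
  -- the lifted terms of group `i₀`, collected in one sum over the whole group
  have hC : c * x ⟨i₀, p i₀⟩ + (∑ j ∈ Finset.univ.erase (p i₀),
      c * max 1 (a ⟨i₀, j⟩ / (c + b - s)) * x ⟨i₀, j⟩)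
      = ∑ j, c * max 1 (a ⟨i₀, j⟩ / (c + (b - s))) * x ⟨i₀, j⟩ := by
    rw [← Finset.add_sum_erase _ _ (Finset.mem_univ (p i₀))]
    have h1 : c / (c + (b - s)) ≤ 1 := (div_le_one (by linarith)).2 (by linarith)
    rw [← hcdef, max_eq_left h1, mul_one, add_sub_assoc]
  obtain ⟨j, hj⟩ :=
    haveI : Nonempty (Fin (n i₀)) := ⟨p i₀⟩
    exists_forall_sum_mul_eq (fun j => x ⟨i₀, j⟩) (hc i₀)
  have hAw : A + a ⟨i₀, j⟩ * x ⟨i₀, j⟩ ≤ b := by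
    rw [← hj (fun j => a ⟨i₀, j⟩), hA, Finset.sum_erase_add _ _ hi₀]
    refine le_trans ?_ hk
    rw [Fintype.sum_sigma]
    exact Finset.sum_le_univ_sum_of_nonneg
      fun i => Finset.sum_nonneg fun j _ => mul_nonneg (ha _) (h01 _).1
  rw [add_assoc, hC, hj (fun j => c * max 1 (a ⟨i₀, j⟩ / (c + (b - s)))), ← Finset.mul_sum]
  obtain ⟨ht0, ht1⟩ := h01 ⟨i₀, j⟩
  by_cases hall : ∀ i ∈ Q, x ⟨i, p i⟩ ≠ 0
  · have hAs : A + c ≤ b - (b - s) := by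
      rw [sub_sub_cancel, hs, ← Finset.sum_erase_add _ _ hi₀, hA]
      gcongr with i hi
      have hle : ∀ j, a ⟨i, j⟩ * x ⟨i, j⟩ ≤ a ⟨i, j⟩ :=
        fun j => mul_le_of_le_one_right (ha _) (h01 _).2
      by_cases hni : n i = 1
      · have : Subsingleton (Fin (n i)) := by rw [hni]; infer_instance
        rw [Fintype.sum_subsingleton _ (p i)]
        exact hle _
      · have hiQ : i ∈ Q := by
          simp only [Finset.mem_erase] at hi
          simp [hQ, hi.1, hi.2, hni]
        rw [sum_mul_eq_of_ne_zero (fun j => x ⟨i, j⟩) (fun j => a ⟨i, j⟩) (hc i) (hall i hiQ)]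
        exact hle _
    have hsum : ∑ i ∈ Q, x ⟨i, p i⟩ ≤ Q.card := by
      simpa using Finset.sum_le_card_nsmul Q (fun i => x ⟨i, p i⟩) 1 fun i _ => (h01 _).2
    have := add_lifted_coeff_mul_le hc0 hd ht1 hAs hAw
    nlinarith
  · push Not at hall
    obtain ⟨i, hi, hxi⟩ := hall
    have hsum : ∑ i ∈ Q, x ⟨i, p i⟩ ≤ (Q.card : ℝ) - 1 := by
      rw [← Finset.sum_erase_add _ _ hi, hxi, ← Finset.card_erase_add_one hi]
      simpa using Finset.sum_le_card_nsmul (Q.erase i) (fun i => x ⟨i, p i⟩) 1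
        fun i _ => (h01 _).2
    have := mul_le_mul_of_nonneg_right (lifted_coeff_le hc0 hd (hcle j)) ht0
    nlinarith

/-- second family of complementarity pack inequalities: validity.
Let `P = {(i, p i) : i ∈ MP}` be a pack with `|M_P ∖ M_0| ≥ 2`, `s = ∑_{(i,j)∈P} a_{ij}`,
and let `(i₀, p i₀) ∈ P` with `i₀ ∉ M_0` and `p i₀ = n_{i₀}` (0-based: `n i₀ - 1`). Then
the inequality (ieq 3) is valid for every point of `PS` (in particular for every point of
`S ⊆ PS`). -/
theorem ckp_pack_ineq2_valid {m : ℕ} (n : Fin m → ℕ) (hn : ∀ i, 0 < n i)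
    (a : CKP.Idx n → ℝ) (b : ℝ)
    (ha : ∀ q : CKP.Idx n, 0 ≤ a q)
    (hmono : ∀ (i : Fin m) (j j' : Fin (n i)), (j : ℕ) ≤ (j' : ℕ) → a ⟨i, j'⟩ ≤ a ⟨i, j⟩)
    (hb : 0 < b)
    (hM : ∃ i, n i ≠ 1)
    (hbig : b < ∑ i : Fin m, a ⟨i, ⟨0, hn i⟩⟩)
    (MP : Finset (Fin m)) (p : ∀ i, Fin (n i))
    (s : ℝ) (hs : s = ∑ i ∈ MP, a ⟨i, p i⟩)
    (hpack : s < b)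
    (hcard : 2 ≤ (MP.filter (fun i => n i ≠ 1)).card)
    (i₀ : Fin m) (hi₀ : i₀ ∈ MP) (hn₀ : n i₀ ≠ 1)
    (hp₀ : (p i₀ : ℕ) = n i₀ - 1)
    (x : CKP.Idx n → ℝ) (hx : x ∈ CKP.PS n a b) :
    (∑ i ∈ MP.erase i₀, ∑ j : Fin (n i), a ⟨i, j⟩ * x ⟨i, j⟩)
      + (∑ i ∈ (MP.filter (fun i => n i ≠ 1)).erase i₀, (b - s) * x ⟨i, p i⟩)
      + a ⟨i₀, p i₀⟩ * x ⟨i₀, p i₀⟩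
      + (∑ j ∈ Finset.univ.erase (p i₀),
          a ⟨i₀, p i₀⟩ * max 1 (a ⟨i₀, j⟩ / (a ⟨i₀, p i₀⟩ + b - s)) * x ⟨i₀, j⟩)
    ≤ b + (((MP.filter (fun i => n i ≠ 1)).card : ℝ) - 2) * (b - s) := by
  have hlin : IsLinearMap ℝ fun y : CKP.Idx n → ℝ =>
      (∑ i ∈ MP.erase i₀, ∑ j : Fin (n i), a ⟨i, j⟩ * y ⟨i, j⟩)
      + (∑ i ∈ (MP.filter (fun i => n i ≠ 1)).erase i₀, (b - s) * y ⟨i, p i⟩)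
      + a ⟨i₀, p i₀⟩ * y ⟨i₀, p i₀⟩
      + (∑ j ∈ Finset.univ.erase (p i₀),
          a ⟨i₀, p i₀⟩ * max 1 (a ⟨i₀, j⟩ / (a ⟨i₀, p i₀⟩ + b - s)) * y ⟨i₀, j⟩) := by
    constructor
    · intro y z
      simp only [Pi.add_apply, mul_add, Finset.sum_add_distrib]
      ring
    · intro r y
      simp only [Pi.smul_apply, smul_eq_mul, mul_add, Finset.mul_sum, mul_left_comm _ r]
  exact convexHull_min (fun y hy =>
    ckp_pack_ineq2_valid_of_mem_S n a b ha hmono MP p s hs hpack i₀ hi₀ hn₀ hp₀ y hy)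
    (convex_halfSpace_le hlin _) hx
end

section
/- (Third family of complementarity pack inequalities: validity.) Let P ⊆ I be a pack with |M_P∖M_0| ≥ 2 and s := ∑_{(i,j)∈P} a_{ij}. Let (i*, j*) ∈ P with i* ∉ M_0 and j* = n_{i*}, and let i' ∈ M_P ∩ M_0 (so (i',1) ∈ P). Then every x ∈ S (hence every x ∈ PS) satisfies (a_{i*j*}·a_{i'1}/(a_{i*j*}+b−s)) x_{i'1} + ∑_{i∈M_P, i∉{i',i*}} ∑_{j∈N_i} a_{ij} x_{ij} + ∑_{(i,j)∈P, i∈M_P∖M_0, i≠i*} ( b−s + (b−s)·a_{i'1}/(a_{i*j*}+b−s) ) x_{ij} + a_{i*j*} x_{i*j*} + ∑_{j∈N_{i*}, j≠j*} a_{i*j*} · max{ 1, a_{i*j} / (a_{i*j*} + b − s) } x_{i*j} ≤ b + (|M_P∖M_0| − 2)(b−s)·(1 + a_{i'1}/(a_{i*j*}+b−s)). -/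
open Finset

namespace CKP

/-- A linear inequality valid on `S` is valid on `PS`. -/
lemma le_on_PS_of_le_on_S {m : ℕ} (n : Fin m → ℕ) (a : Idx n → ℝ) (b : ℝ)
    (f : (Idx n → ℝ) → ℝ) (r : ℝ) (hf : IsLinearMap ℝ f) (h : ∀ x ∈ S n a b, f x ≤ r) :
    ∀ x ∈ PS n a b, f x ≤ r :=
  fun _ hx => convexHull_min (t := {x | f x ≤ r}) h (convex_halfSpace_le hf r) hx

end CKP

/-- third family of complementarity pack inequalities: validity.
Let `P = {(i, p i) : i ∈ MP}` be a pack with `|M_P ∖ M_0| ≥ 2`, `s = ∑_{(i,j)∈P} a_{ij}`,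
let `(i₀, p i₀) ∈ P` with `i₀ ∉ M_0` and `p i₀ = n_{i₀}` (0-based: `n i₀ - 1`), and let
`i' ∈ M_P ∩ M_0` (so that `(i', 1) = (i', p i') ∈ P`). Then the inequality (ieq 4) is
valid for every point of `PS` (in particular for every point of `S ⊆ PS`). -/
theorem ckp_pack_ineq3_valid {m : ℕ} (n : Fin m → ℕ) (hn : ∀ i, 0 < n i)
    (a : CKP.Idx n → ℝ) (b : ℝ)
    (ha : ∀ q : CKP.Idx n, 0 ≤ a q)
    (hmono : ∀ (i : Fin m) (j j' : Fin (n i)), (j : ℕ) ≤ (j' : ℕ) → a ⟨i, j'⟩ ≤ a ⟨i, j⟩)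
    (hb : 0 < b)
    (hM : ∃ i, n i ≠ 1)
    (hbig : b < ∑ i : Fin m, a ⟨i, ⟨0, hn i⟩⟩)
    (MP : Finset (Fin m)) (p : ∀ i, Fin (n i))
    (s : ℝ) (hs : s = ∑ i ∈ MP, a ⟨i, p i⟩)
    (hpack : s < b)
    (hcard : 2 ≤ (MP.filter (fun i => n i ≠ 1)).card)
    (i₀ : Fin m) (hi₀ : i₀ ∈ MP) (hn₀ : n i₀ ≠ 1)
    (hp₀ : (p i₀ : ℕ) = n i₀ - 1)
    (i' : Fin m) (hi' : i' ∈ MP) (hn' : n i' = 1)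
    (x : CKP.Idx n → ℝ) (hx : x ∈ CKP.PS n a b) :
    (a ⟨i₀, p i₀⟩ * a ⟨i', p i'⟩ / (a ⟨i₀, p i₀⟩ + b - s)) * x ⟨i', p i'⟩
      + (∑ i ∈ (MP.erase i').erase i₀, ∑ j : Fin (n i), a ⟨i, j⟩ * x ⟨i, j⟩)
      + (∑ i ∈ (MP.filter (fun i => n i ≠ 1)).erase i₀,
          (b - s + (b - s) * a ⟨i', p i'⟩ / (a ⟨i₀, p i₀⟩ + b - s)) * x ⟨i, p i⟩)
      + a ⟨i₀, p i₀⟩ * x ⟨i₀, p i₀⟩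
      + (∑ j ∈ Finset.univ.erase (p i₀),
          a ⟨i₀, p i₀⟩ * max 1 (a ⟨i₀, j⟩ / (a ⟨i₀, p i₀⟩ + b - s)) * x ⟨i₀, j⟩)
    ≤ b + (((MP.filter (fun i => n i ≠ 1)).card : ℝ) - 2) * (b - s)
        * (1 + a ⟨i', p i'⟩ / (a ⟨i₀, p i₀⟩ + b - s)) := by
  set c := a ⟨i', p i'⟩ with hc
  set α := a ⟨i₀, p i₀⟩ with hα
  have hc0 : 0 ≤ c := ha _
  have hα0 : 0 ≤ α := ha _
  have hD : 0 < α + b - s := by linarith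
  set K := (MP.filter (fun i => n i ≠ 1)).erase i₀ with hK
  have hi₀K : i₀ ∈ MP.filter (fun i => n i ≠ 1) := by simp [hi₀, hn₀]
  have hKcard : (((MP.filter (fun i => n i ≠ 1)).card : ℕ) : ℝ) = K.card + 1 := by
    rw [← Finset.card_erase_add_one hi₀K]; push_cast; rfl
  rw [hKcard]
  have hne : i₀ ≠ i' := fun h => hn₀ (h ▸ hn')
  have hi₀' : i₀ ∈ MP.erase i' := Finset.mem_erase.2 ⟨hne, hi₀⟩
  revert x
  refine CKP.le_on_PS_of_le_on_S n a b _ _ ?_ ?_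
  · constructor
    · intro x y
      simp only [Pi.add_apply, mul_add, Finset.sum_add_distrib]
      ring
    · intro r x
      simp only [Pi.smul_apply, smul_eq_mul, mul_left_comm _ r, ← Finset.mul_sum, ← mul_add]
  intro x hx
  obtain ⟨hx01, hknap, hcomp⟩ := hx
  have h0 : ∀ q, 0 ≤ x q := fun q => (hx01 q).1
  have h1 : ∀ q, x q ≤ 1 := fun q => (hx01 q).2
  have hlast : ∀ j : Fin (n i₀), α ≤ a ⟨i₀, j⟩ := fun j =>
    hmono i₀ j (p i₀) (by have := j.isLt; omega)
  set O := ∑ i ∈ (MP.erase i').erase i₀, ∑ j : Fin (n i), a ⟨i, j⟩ * x ⟨i, j⟩ with hO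
  have hO0 : 0 ≤ O := Finset.sum_nonneg fun i _ => Finset.sum_nonneg fun j _ =>
    mul_nonneg (ha _) (h0 _)
  have hu0 := h0 ⟨i', p i'⟩
  have hu1 := h1 ⟨i', p i'⟩
  have hweight : c * x ⟨i', p i'⟩ + O + ∑ j, a ⟨i₀, j⟩ * x ⟨i₀, j⟩ ≤ b := by
    rw [Fintype.sum_sigma] at hknap
    refine le_trans ?_ (le_trans (Finset.sum_le_sum_of_subset_of_nonneg
      (Finset.subset_univ MP) fun i _ _ => Finset.sum_nonneg fun j _ =>
        mul_nonneg (ha _) (h0 _)) hknap)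
    rw [← Finset.add_sum_erase _ _ hi', ← Finset.add_sum_erase _ _ hi₀']
    have := Finset.single_le_sum (f := fun j => a ⟨i', j⟩ * x ⟨i', j⟩)
      (fun j _ => mul_nonneg (ha _) (h0 _)) (Finset.mem_univ (p i'))
    linarith
  obtain ⟨j₀, hj₀⟩ : ∃ j₀, ∀ j, j ≠ j₀ → x ⟨i₀, j⟩ = 0 := by
    by_cases h : ∃ j₀, x ⟨i₀, j₀⟩ ≠ 0
    · obtain ⟨j₀, h⟩ := h
      exact ⟨j₀, fun j hj => (mul_eq_zero.1 (hcomp i₀ j j₀ hj)).resolve_right h⟩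
    · push Not at h
      exact ⟨p i₀, fun j _ => h j⟩
  have hz0 := h0 ⟨i₀, j₀⟩
  have hz1 := h1 ⟨i₀, j₀⟩
  have hA := hlast j₀
  have hsum₀ : ∑ j, a ⟨i₀, j⟩ * x ⟨i₀, j⟩ = a ⟨i₀, j₀⟩ * x ⟨i₀, j₀⟩ :=
    Finset.sum_eq_single j₀ (fun j _ hj => by rw [hj₀ j hj, mul_zero]) (by simp)
  rw [hsum₀] at hweight
  have hW : α * x ⟨i₀, p i₀⟩ + (∑ j ∈ Finset.univ.erase (p i₀),
      α * max 1 (a ⟨i₀, j⟩ / (α + b - s)) * x ⟨i₀, j⟩) ≤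
      α * max 1 (a ⟨i₀, j₀⟩ / (α + b - s)) * x ⟨i₀, j₀⟩ := by
    have hle : α * x ⟨i₀, p i₀⟩ ≤
        α * max 1 (a ⟨i₀, p i₀⟩ / (α + b - s)) * x ⟨i₀, p i₀⟩ :=
      mul_le_mul_of_nonneg_right (le_mul_of_one_le_right hα0 (le_max_left _ _)) (h0 _)
    have hsum : ∑ j, α * max 1 (a ⟨i₀, j⟩ / (α + b - s)) * x ⟨i₀, j⟩ =
        α * max 1 (a ⟨i₀, j₀⟩ / (α + b - s)) * x ⟨i₀, j₀⟩ :=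
      Finset.sum_eq_single j₀ (fun j _ hj => by rw [hj₀ j hj, mul_zero]) (by simp)
    rw [← Finset.add_sum_erase _ _ (Finset.mem_univ (p i₀))] at hsum
    linarith
  have hθ0 : 0 ≤ b - s + (b - s) * c / (α + b - s) :=
    add_nonneg (by linarith) (div_nonneg (mul_nonneg (by linarith) hc0) hD.le)
  rw [← Finset.mul_sum]
  have hmaxD : α * max 1 (a ⟨i₀, j₀⟩ / (α + b - s)) ≤ a ⟨i₀, j₀⟩ := by
    rw [mul_max_of_nonneg _ _ hα0, max_le_iff]
    refine ⟨by linarith, ?_⟩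
    rw [mul_div_assoc', div_le_iff₀ hD, mul_comm]
    exact mul_le_mul_of_nonneg_left (by linarith) (ha _)
  have hfrac : α * c / (α + b - s) ≤ c := by
    rw [div_le_iff₀ hD, mul_comm]
    exact mul_le_mul_of_nonneg_left (by linarith) hc0
  have hθ : (b - s) * (1 + c / (α + b - s)) = b - s + (b - s) * c / (α + b - s) := by ring
  have hrhs : ((K.card : ℝ) + 1 - 2) * (b - s) * (1 + c / (α + b - s)) =
      (b - s + (b - s) * c / (α + b - s)) * ((K.card : ℝ) - 1) := by
    rw [mul_assoc, hθ]; ring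
  rw [hrhs]
  by_cases hcase : ∃ i ∈ K, x ⟨i, p i⟩ = 0
  · obtain ⟨k, hkK, hk⟩ := hcase
    have hY : ∑ i ∈ K, x ⟨i, p i⟩ ≤ (K.card : ℝ) - 1 := by
      rw [← Finset.add_sum_erase _ _ hkK, hk, zero_add, ← Finset.card_erase_add_one hkK]
      push_cast
      rw [add_sub_cancel_right]
      simpa using Finset.sum_le_card_nsmul (K.erase k) (fun i => x ⟨i, p i⟩) 1
        (fun i _ => h1 _)
    have e1 := mul_le_mul_of_nonneg_left hY hθ0
    have e2 := mul_le_mul_of_nonneg_right hfrac hu0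
    have e3 := mul_le_mul_of_nonneg_right hmaxD hz0
    linarith
  · push Not at hcase
    have hY : ∑ i ∈ K, x ⟨i, p i⟩ ≤ (K.card : ℝ) := by
      simpa using Finset.sum_le_card_nsmul K (fun i => x ⟨i, p i⟩) 1 (fun i _ => h1 _)
    have e1 := mul_le_mul_of_nonneg_left hY hθ0
    have hOs : O ≤ s - c - α := by
      have hs' : s - c - α = ∑ i ∈ (MP.erase i').erase i₀, a ⟨i, p i⟩ := by
        rw [hs, ← Finset.add_sum_erase _ _ hi', ← Finset.add_sum_erase _ _ hi₀']
        ring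
      rw [hs', hO]
      refine Finset.sum_le_sum fun i hi => ?_
      rw [Finset.mem_erase, Finset.mem_erase] at hi
      have hz : ∀ j, j ≠ p i → x ⟨i, j⟩ = 0 := by
        intro j hj
        by_cases hni : n i = 1
        · exact absurd (Fin.ext (by have := j.isLt; have := (p i).isLt; omega)) hj
        · refine (mul_eq_zero.1 (hcomp i j (p i) hj)).resolve_right (hcase i ?_)
          simp [hK, hi.1, hi.2.2, hni]
      rw [Finset.sum_eq_single (p i) (fun j _ hj => by rw [hz j hj, mul_zero]) (by simp)]
      exact mul_le_of_le_one_right (ha _) (h1 _)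
    have hcD : α * c / (α + b - s) + (b - s) * c / (α + b - s) = c := by
      field_simp
      ring
    have hfrac0 : 0 ≤ α * c / (α + b - s) := div_nonneg (mul_nonneg hα0 hc0) hD.le
    rcases le_total (a ⟨i₀, j₀⟩) (α + b - s) with hAD | hAD
    · rw [max_eq_left ((div_le_one hD).2 hAD), mul_one] at hW
      have e2 := mul_le_of_le_one_right hfrac0 hu1
      have e3 := mul_le_of_le_one_right hα0 hz1
      linarith
    · rw [max_eq_right ((one_le_div hD).2 hAD)] at hW
      have key : α * c / (α + b - s) * x ⟨i', p i'⟩ + O +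
          α * (a ⟨i₀, j₀⟩ / (α + b - s)) * x ⟨i₀, j₀⟩ +
          (b - s + (b - s) * c / (α + b - s)) ≤ b := by
        have e2 := mul_le_mul_of_nonneg_left hweight hα0
        have e3 := mul_le_mul_of_nonneg_left hOs (sub_nonneg.2 hpack.le)
        have e4 : α * c / (α + b - s) * x ⟨i', p i'⟩ + O +
            α * (a ⟨i₀, j₀⟩ / (α + b - s)) * x ⟨i₀, j₀⟩ +
            (b - s + (b - s) * c / (α + b - s)) =
            (α * (c * x ⟨i', p i'⟩ + O + a ⟨i₀, j₀⟩ * x ⟨i₀, j₀⟩) + (b - s) * O +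
              (b - s) * (α + b - s) + (b - s) * c) / (α + b - s) := by
          field_simp
          ring
        rw [e4, div_le_iff₀ hD]
        linarith
      linarith
end
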